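/- arXiv:1802.01046 — 2 statements merged into one kernel-verified Lean document; each statement's English description precedes it below -/
import Mathlib

section
/- Every centrally symmetric 3-dimensional smooth lattice polytope has the integer decomposition property. -/
open Set Pointwise

/-- Cast an integer vector to a real vector. -/
def toR {d : ℕ} (z : Fin d → ℤ) : Fin d → ℝ := fun i => (z i : ℝ)

/-- A lattice polytope: the convex hull of finitely many integer points. -/
def IsLatticePolytope {d : ℕ} (P : Set (Fin d → ℝ)) : Prop :=
  ∃ V : Finset (Fin d → ℤ), P = convexHull ℝ (toR '' (V : Set (Fin d → ℤ)))

/-- `x` is a lattice point. -/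
def IsLatticePt {d : ℕ} (x : Fin d → ℝ) : Prop := ∃ z : Fin d → ℤ, x = toR z

/-- The integer decomposition property: every lattice point of the `n`-th dilate
of `P` is a sum of `n` lattice points of `P`. -/
def HasIDP {d : ℕ} (P : Set (Fin d → ℝ)) : Prop :=
  ∀ n : ℕ, 1 ≤ n → ∀ p : Fin d → ℝ, p ∈ (n : ℝ) • P → IsLatticePt p →
    ∃ q : Fin n → (Fin d → ℝ), (∀ i, q i ∈ P ∧ IsLatticePt (q i)) ∧ ∑ i, q i = p

/-- The tangent cone of `P` at `v`. -/
def coneAt {d : ℕ} (P : Set (Fin d → ℝ)) (v : Fin d → ℝ) : Set (Fin d → ℝ) :=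
  {y | ∃ t : ℝ, 0 ≤ t ∧ ∃ x ∈ P, y = t • (x - v)}

/-- A smooth lattice polytope: at every vertex the tangent cone is generated by
linearly independent lattice vectors (this encodes simplicity; these generators
are exactly the primitive edge directions at the vertex) which moreover form a
`ℤ`-basis of the lattice of integer vectors parallel to the affine hull of `P`. -/
def IsSmoothPolytope {d : ℕ} (P : Set (Fin d → ℝ)) : Prop :=
  IsLatticePolytope P ∧
    ∀ v ∈ Set.extremePoints ℝ P, ∃ (k : ℕ) (e : Fin k → (Fin d → ℤ)),
      LinearIndependent ℤ e ∧
      coneAt P v = {y | ∃ t : Fin k → ℝ, (∀ i, 0 ≤ t i) ∧ y = ∑ i, t i • toR (e i)} ∧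
      ∀ z : Fin d → ℤ, toR z ∈ vectorSpan ℝ P → z ∈ Submodule.span ℤ (Set.range e)

/-- Lattice points of a smooth polygon, described combinatorially. -/
structure Sm2 (S : Set (ℤ × ℤ)) : Prop where
  fin : S.Finite
  conv : ∀ (z a b c d : ℤ × ℤ) (i j k l : ℤ), a ∈ S → b ∈ S → c ∈ S → d ∈ S →
    0 ≤ i → 0 ≤ j → 0 ≤ k → 0 ≤ l → 0 < i + j + k + l →
    (i + j + k + l) * z.1 = i * a.1 + j * b.1 + k * c.1 + l * d.1 →
    (i + j + k + l) * z.2 = i * a.2 + j * b.2 + k * c.2 + l * d.2 → z ∈ S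
  smooth : ∀ w ∈ S, ∀ p q : ℤ,
    (∀ z ∈ S, z ≠ w → p * z.1 + q * z.2 < p * w.1 + q * w.2) →
    ∃ f g : ℤ × ℤ, w + f ∈ S ∧ w + g ∈ S ∧
      ∀ z ∈ S, ∃ i j : ℤ, 0 ≤ i ∧ 0 ≤ j ∧
        z.1 = w.1 + i * f.1 + j * g.1 ∧ z.2 = w.2 + i * f.2 + j * g.2

theorem Sm2.map {S : Set (ℤ × ℤ)} (hS : Sm2 S) (a b c d s t e : ℤ)
    (he : e * e = 1) (hd : a * d - b * c = e) :
    Sm2 {z : ℤ × ℤ | ((a * z.1 + b * z.2 + s, c * z.1 + d * z.2 + t) : ℤ × ℤ) ∈ S} := by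
  have inv : ∀ z' : ℤ × ℤ, ∃ z : ℤ × ℤ, a * z.1 + b * z.2 + s = z'.1 ∧ c * z.1 + d * z.2 + t = z'.2 := by
    intro z'
    refine ⟨(e * (d * (z'.1 - s) - b * (z'.2 - t)), e * (-c * (z'.1 - s) + a * (z'.2 - t))), ?_, ?_⟩
    · simp only
      linear_combination (z'.1 - s) * he + e * (z'.1 - s) * hd
    · simp only
      linear_combination (z'.2 - t) * he + e * (z'.2 - t) * hd
  have linv1 : ∀ x y : ℤ, e * (d * (a * x + b * y) - b * (c * x + d * y)) = x := by
    intro x y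
    linear_combination x * he + e * x * hd
  have linv2 : ∀ x y : ℤ, e * (-c * (a * x + b * y) + a * (c * x + d * y)) = y := by
    intro x y
    linear_combination y * he + e * y * hd
  refine ⟨?_, ?_, ?_⟩
  · apply Set.Finite.preimage _ hS.fin
    intro x _ y _ hxy
    simp only [Prod.mk.injEq] at hxy
    obtain ⟨h1, h2⟩ := hxy
    have h1' : a * x.1 + b * x.2 = a * y.1 + b * y.2 := by linarith
    have h2' : c * x.1 + d * x.2 = c * y.1 + d * y.2 := by linarith
    have e1 := linv1 x.1 x.2
    have e2 := linv2 x.1 x.2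
    rw [h1', h2', linv1] at e1
    rw [h1', h2', linv2] at e2
    exact Prod.ext e1.symm e2.symm
  · intro z z1 z2 z3 z4 i j k l h1 h2 h3 h4 hi hj hk hl hp e1 e2
    refine hS.conv _ _ _ _ _ i j k l h1 h2 h3 h4 hi hj hk hl hp ?_ ?_
    · simp only
      linear_combination a * e1 + b * e2
    · simp only
      linear_combination c * e1 + d * e2
  · intro w hw p q hmax
    obtain ⟨f, g, hf, hg, hall⟩ := hS.smooth _ hw (e * (p * d - q * c)) (e * (-p * b + q * a)) (by
      intro z' hz' hne
      obtain ⟨z, e1, e2⟩ := inv z'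
      have hz : z' = (a * z.1 + b * z.2 + s, c * z.1 + d * z.2 + t) := Prod.ext e1.symm e2.symm
      have hzw : z ≠ w := by
        rintro rfl
        exact hne hz
      have := hmax z (by rw [hz] at hz'; exact hz') hzw
      rw [hz]
      simp only
      have k1 : ∀ x y : ℤ, e * (p * d - q * c) * (a * x + b * y + s) + e * (-p * b + q * a) * (c * x + d * y + t)
          = p * x + q * y + (e * (p * d - q * c) * s + e * (-p * b + q * a) * t) := by
        intro x y
        linear_combination p * linv1 x y + q * linv2 x y
      rw [k1, k1]
      linarith)
    have lin : ∀ f : ℤ × ℤ, ∃ f' : ℤ × ℤ, a * f'.1 + b * f'.2 = f.1 ∧ c * f'.1 + d * f'.2 = f.2 := by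
      intro f
      obtain ⟨z, e1, e2⟩ := inv (f + (s, t))
      refine ⟨z, ?_, ?_⟩
      · simp at e1; linarith
      · simp at e2; linarith
    obtain ⟨f', f1, f2⟩ := lin f
    obtain ⟨g', g1, g2⟩ := lin g
    refine ⟨f', g', ?_, ?_, ?_⟩
    · simp only [Set.mem_ofPred_eq]
      convert hf using 1
      ext
      · simp; linear_combination f1
      · simp; linear_combination f2
    · simp only [Set.mem_ofPred_eq]
      convert hg using 1
      ext
      · simp; linear_combination g1
      · simp; linear_combination g2
    · intro z hz
      obtain ⟨i, j, hi, hj, e1, e2⟩ := hall _ hz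
      refine ⟨i, j, hi, hj, ?_, ?_⟩
      · simp only at e1 e2
        have := linv1 z.1 z.2
        rw [← this]
        have := linv1 w.1 w.2
        have h3 := linv1 f'.1 f'.2
        have h4 := linv1 g'.1 g'.2
        rw [f1, f2] at h3
        rw [g1, g2] at h4
        linear_combination e * d * e1 - e * b * e2 + this + i * h3 + j * h4
      · simp only at e1 e2
        have := linv2 z.1 z.2
        rw [← this]
        have := linv2 w.1 w.2
        have h3 := linv2 f'.1 f'.2
        have h4 := linv2 g'.1 g'.2
        rw [f1, f2] at h3
        rw [g1, g2] at h4
        linear_combination e * a * e2 - e * c * e1 + this + i * h3 + j * h4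

theorem Sm2.conv3 {S : Set (ℤ × ℤ)} (hS : Sm2 S) (z a b c : ℤ × ℤ) (i j k : ℤ) (ha : a ∈ S) (hb : b ∈ S)
    (hc : c ∈ S) (hi : 0 ≤ i) (hj : 0 ≤ j) (hk : 0 ≤ k) (hp : 0 < i + j + k)
    (h1 : (i + j + k) * z.1 = i * a.1 + j * b.1 + k * c.1)
    (h2 : (i + j + k) * z.2 = i * a.2 + j * b.2 + k * c.2) : z ∈ S :=
  hS.conv z a b c a i j k 0 ha hb hc ha hi hj hk le_rfl (by omega) (by simpa using h1) (by simpa using h2)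

/-- A product of an integer that is nonnegative with a nonpositive one summing to `-1`. -/
theorem split_neg_one {i j x y : ℤ} (hi : 0 ≤ i) (hj : 0 ≤ j) (hx : x ≤ 0) (hy : y ≤ 0)
    (h : i * x + j * y = -1) : (i = 1 ∧ x = -1 ∧ j * y = 0) ∨ (j = 1 ∧ y = -1 ∧ i * x = 0) := by
  have h1 : i * x ≤ 0 := mul_nonpos_of_nonneg_of_nonpos hi hx
  have h2 : j * y ≤ 0 := mul_nonpos_of_nonneg_of_nonpos hj hy
  rcases (by omega : i * x = -1 ∨ j * y = -1) with h3 | h3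
  · left
    have : i = 1 := by
      have : i ∣ 1 := ⟨-x, by linarith⟩
      exact Int.eq_one_of_dvd_one hi this
    subst this
    omega
  · right
    have : j = 1 := by
      have : j ∣ 1 := ⟨-y, by linarith⟩
      exact Int.eq_one_of_dvd_one hj this
    subst this
    omega

theorem Sm2.sq_aux {S : Set (ℤ × ℤ)} (hS : Sm2 S) (h00 : ((0, 0) : ℤ × ℤ) ∈ S)
    (h10 : ((1, 0) : ℤ × ℤ) ∈ S) (h01 : ((0, 1) : ℤ × ℤ) ∈ S)
    (hpos : ∀ z ∈ S, 0 ≤ z.1 ∧ 0 ≤ z.2) (m : ℤ) (hm : 2 ≤ m) (hmS : ((m, 0) : ℤ × ℤ) ∈ S) :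
    ((1, 1) : ℤ × ℤ) ∈ S := by
  by_contra hn
  have ax : ∀ z ∈ S, z.1 = 0 ∨ z.2 = 0 := by
    intro z hz
    by_contra hcon
    push Not at hcon
    have := hpos z hz
    apply hn
    have h1 : 1 ≤ z.1 := by omega
    have h2 : 1 ≤ z.2 := by omega
    refine hS.conv3 _ _ _ _ (z.2 - 1) (z.1 - 1) 1 h10 h01 hz (by omega) (by omega) (by omega) (by omega) ?_ ?_
    · simp only; ring
    · simp only; ring
  have h20 : ((2, 0) : ℤ × ℤ) ∈ S := by
    refine hS.conv3 _ _ _ _ (m - 2) 2 0 h00 hmS h00 (by omega) (by omega) (by omega) (by omega) ?_ ?_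
    · simp only; ring
    · simp only; ring
  obtain ⟨w, hw, hmax⟩ := Set.exists_max_image S (fun z => z.2) hS.fin ⟨_, h00⟩
  have hb : 1 ≤ w.2 := hmax _ h01
  have hw1 : w.1 = 0 := by
    rcases ax w hw with h | h
    · exact h
    · omega
  obtain ⟨f, g, hf, hg, hall⟩ := hS.smooth w hw 0 1 (by
    intro z hz hne
    have h1 := hmax z hz
    rcases ax z hz with h | h
    · have : z.2 ≠ w.2 := fun h' => hne (Prod.ext (by omega) h')
      omega
    · omega)
  have key : ∀ f g : ℤ × ℤ, w + f ∈ S → w + g ∈ S → (∀ z ∈ S, ∃ i j : ℤ, 0 ≤ i ∧ 0 ≤ j ∧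
        z.1 = w.1 + i * f.1 + j * g.1 ∧ z.2 = w.2 + i * f.2 + j * g.2) → f.1 = 0 → f.2 = -1 → False := by
    intro f g hf hg hall hf1 hf2
    obtain ⟨i, j, hi, hj, e1, e2⟩ := hall _ h10
    obtain ⟨i', j', hi', hj', e1', e2'⟩ := hall _ h20
    have pg := hpos _ hg
    have ag := ax _ hg
    simp only [hf1, hf2, hw1, Prod.fst_add, Prod.snd_add] at *
    have hj1 : j = 1 := Int.eq_one_of_dvd_one hj ⟨g.1, by linarith⟩
    subst hj1
    have hg1 : g.1 = 1 := by linarith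
    have hg2 : g.2 = - w.2 := by omega
    rw [hg1] at e1'
    rw [hg2] at e2'
    have : j' = 2 := by linarith
    subst this
    omega
  have hz0 : ((0, w.2 - 1) : ℤ × ℤ) ∈ S := by
    refine hS.conv3 _ _ _ _ 1 (w.2 - 1) 0 h00 hw h00 (by omega) (by omega) (by omega) (by omega) ?_ ?_
    · simp only [hw1]; ring
    · simp only; ring
  obtain ⟨i, j, hi, hj, e1, e2⟩ := hall _ hz0
  have pf := hpos _ hf
  have pg := hpos _ hg
  have mf := hmax _ hf
  have mg := hmax _ hg
  simp only [hw1, Prod.fst_add, Prod.snd_add] at pf pg mf mg e1 e2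
  have hif : 0 ≤ i * f.1 := mul_nonneg hi (by omega)
  have hjg : 0 ≤ j * g.1 := mul_nonneg hj (by omega)
  rcases split_neg_one hi hj (by omega : f.2 ≤ 0) (by omega : g.2 ≤ 0) (by linarith) with ⟨a1, a2, a3⟩ | ⟨a1, a2, a3⟩
  · subst a1
    exact key f g hf hg hall (by omega) a2
  · subst a1
    exact key g f hg hf (by
      intro z hz
      obtain ⟨i, j, hi, hj, e1, e2⟩ := hall z hz
      exact ⟨j, i, hj, hi, by linarith, by linarith⟩) (by omega) a2

theorem Sm2.swap {S : Set (ℤ × ℤ)} (hS : Sm2 S) : Sm2 {z : ℤ × ℤ | ((z.2, z.1) : ℤ × ℤ) ∈ S} := by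
  have := hS.map 0 1 1 0 0 0 (-1) (by norm_num) (by norm_num)
  simpa using this

theorem Sm2.sq {S : Set (ℤ × ℤ)} (hS : Sm2 S) (h00 : ((0, 0) : ℤ × ℤ) ∈ S)
    (h10 : ((1, 0) : ℤ × ℤ) ∈ S) (h01 : ((0, 1) : ℤ × ℤ) ∈ S)
    (hpos : ∀ z ∈ S, 0 ≤ z.1 ∧ 0 ≤ z.2)
    (h4 : ∃ z ∈ S, z ≠ (0, 0) ∧ z ≠ (1, 0) ∧ z ≠ (0, 1)) :
    ((1, 1) : ℤ × ℤ) ∈ S := by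
  obtain ⟨⟨x, y⟩, hz, n1, n2, n3⟩ := h4
  simp only [ne_eq, Prod.mk.injEq] at n1 n2 n3
  have hp := hpos _ hz
  simp only at hp
  rcases (by omega : (1 ≤ x ∧ 1 ≤ y) ∨ (2 ≤ x ∧ y = 0) ∨ (x = 0 ∧ 2 ≤ y)) with h | h | h
  · refine hS.conv3 _ _ _ _ (y - 1) (x - 1) 1 h10 h01 hz (by omega) (by omega) (by omega) (by omega) ?_ ?_
    · simp only; ring
    · simp only; ring
  · obtain ⟨h1, rfl⟩ := h
    exact hS.sq_aux h00 h10 h01 hpos x h1 hz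
  · obtain ⟨rfl, h1⟩ := h
    exact hS.swap.sq_aux h00 h01 h10 (fun z hz => (hpos _ hz).symm) y h1 hz

/-- Core of the reflection lemma. -/
theorem Sm2.core {S : Set (ℤ × ℤ)} (hS : Sm2 S) (h00 : ((0, 0) : ℤ × ℤ) ∈ S)
    (h10 : ((1, 0) : ℤ × ℤ) ∈ S) (h01 : ((0, 1) : ℤ × ℤ) ∈ S)
    (h4 : ∀ a b c : ℤ × ℤ, ∃ z ∈ S, z ≠ a ∧ z ≠ b ∧ z ≠ c)
    (hn1 : ((1, 1) : ℤ × ℤ) ∉ S) (hn2 : ((-1, 1) : ℤ × ℤ) ∉ S) (hn3 : ((1, -1) : ℤ × ℤ) ∉ S)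
    (hs : ∀ z ∈ S, 1 ≤ z.2 → z.1 + z.2 ≤ 1) : False := by
  have hs' : ∀ z ∈ S, 1 ≤ z.2 → z.1 + z.2 = 1 := by
    intro z hz h1
    by_contra hcon
    have h2 := hs z hz h1
    apply hn2
    refine hS.conv3 _ _ _ _ (z.2 - 1) (- z.1 - z.2) 1 h00 h01 hz (by omega) (by omega) (by omega) (by omega) ?_ ?_
    · simp only; ring
    · simp only; ring
  obtain ⟨w, hw, hmax⟩ := Set.exists_max_image S (fun z => z.2) hS.fin ⟨_, h00⟩
  have hH : 1 ≤ w.2 := hmax _ h01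
  have hw1 := hs' w hw hH
  obtain ⟨f, g, hf, hg, hall⟩ := hS.smooth w hw 0 1 (by
    intro z hz hne
    have h1 := hmax z hz
    have : z.2 ≠ w.2 := fun h' => hne (Prod.ext (by have := hs' z hz (by omega); omega) h')
    omega)
  have key : ∀ f g : ℤ × ℤ, w + f ∈ S → w + g ∈ S → (∀ z ∈ S, ∃ i j : ℤ, 0 ≤ i ∧ 0 ≤ j ∧
        z.1 = w.1 + i * f.1 + j * g.1 ∧ z.2 = w.2 + i * f.2 + j * g.2) → f.1 = 1 → f.2 = -1 → False := by
    intro f g hf hg hall hf1 hf2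
    obtain ⟨i, j, hi, hj, e1, e2⟩ := hall _ h00
    simp only [hf1, hf2] at e1 e2
    have hj1 : j = 1 := Int.eq_one_of_dvd_one hj ⟨-(g.1 + g.2), by linarith⟩
    subst hj1
    have h5 : ¬ (1 ≤ (w + g).2) := by
      intro h6
      have := hs' _ hg h6
      simp only [Prod.fst_add, Prod.snd_add] at this
      omega
    simp only [Prod.snd_add] at h5
    have hi0 : i = 0 := by omega
    subst hi0
    have hg1 : g.1 = w.2 - 1 := by omega
    have hg2 : g.2 = - w.2 := by omega
    have hw1' : w.1 = 1 - w.2 := by omega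
    have hS' := hS.map 1 (w.2 - 1) (-1) (-w.2) (1 - w.2) w.2 (-1) (by norm_num) (by ring)
    have := hS'.sq (by
        simp only [Set.mem_ofPred_eq]
        convert hw using 1
        ext <;> simp [hw1'])
      (by
        simp only [Set.mem_ofPred_eq]
        convert hf using 1
        ext <;> simp [hw1', hf1, hf2] <;> ring)
      (by
        simp only [Set.mem_ofPred_eq]
        convert hg using 1
        ext <;> simp [hw1', hg1, hg2])
      (by
        intro z hz
        obtain ⟨i, j, hi, hj, e1, e2⟩ := hall _ hz
        simp only [hw1', hf1, hf2, hg1, hg2] at e1 e2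
        have hj2 : j = z.2 := by linarith
        subst hj2
        exact ⟨by linarith, hj⟩)
      (by
        obtain ⟨z, hz, n1, n2, n3⟩ := h4 w (w + f) (w + g)
        obtain ⟨i, j, hi, hj, e1, e2⟩ := hall _ hz
        simp only [hw1', hf1, hf2, hg1, hg2] at e1 e2
        refine ⟨(i, j), ?_, ?_, ?_, ?_⟩
        · simp only [Set.mem_ofPred_eq]
          convert hz using 1
          ext
          · simp only [e1]; ring
          · simp only [e2]; ring
        · rintro h
          simp only [Prod.mk.injEq] at h
          obtain ⟨rfl, rfl⟩ := h
          exact n1 (Prod.ext (by linarith) (by linarith))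
        · rintro h
          simp only [Prod.mk.injEq] at h
          obtain ⟨rfl, rfl⟩ := h
          exact n2 (Prod.ext (by simp only [Prod.fst_add]; linarith) (by simp only [Prod.snd_add]; linarith))
        · rintro h
          simp only [Prod.mk.injEq] at h
          obtain ⟨rfl, rfl⟩ := h
          exact n3 (Prod.ext (by simp only [Prod.fst_add]; linarith) (by simp only [Prod.snd_add]; linarith)))
    apply hn3
    simp only [Set.mem_ofPred_eq] at this
    convert this using 1
    ext <;> simp
  have hz0 : ((w.1 + 1, w.2 - 1) : ℤ × ℤ) ∈ S := by
    refine hS.conv3 _ _ _ _ (w.2 - 1) 1 0 hw h10 h00 (by omega) (by omega) (by omega) (by omega) ?_ ?_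
    · simp only
      have : w.1 = 1 - w.2 := by omega
      rw [this]; ring
    · simp only; ring
  obtain ⟨i, j, hi, hj, e1, e2⟩ := hall _ hz0
  have zf : f.2 = 0 → f.1 = 0 := by
    intro h
    have := hs' _ hf (by simp [h, hH])
    simp [h] at this
    omega
  have zg : g.2 = 0 → g.1 = 0 := by
    intro h
    have := hs' _ hg (by simp [h, hH])
    simp [h] at this
    omega
  have mf := hmax _ hf
  have mg := hmax _ hg
  simp only [Prod.snd_add] at mf mg e1 e2
  have z0 : ∀ i a b : ℤ, (b = 0 → a = 0) → i * b = 0 → i * a = 0 := by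
    intro i a b h h'
    rcases mul_eq_zero.mp h' with h'' | h''
    · simp [h'']
    · simp [h h'']
  rcases split_neg_one hi hj (by omega : f.2 ≤ 0) (by omega : g.2 ≤ 0) (by linarith) with ⟨a1, a2, a3⟩ | ⟨a1, a2, a3⟩
  · subst a1
    have := z0 _ _ _ zg a3
    exact key f g hf hg hall (by omega) a2
  · subst a1
    have := z0 _ _ _ zf a3
    exact key g f hg hf (by
      intro z hz
      obtain ⟨i, j, hi, hj, e1, e2⟩ := hall z hz
      exact ⟨j, i, hj, hi, by linarith, by linarith⟩) (by omega) a2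

theorem Sm2.reflect_std {S : Set (ℤ × ℤ)} (hS : Sm2 S) (h00 : ((0, 0) : ℤ × ℤ) ∈ S)
    (h10 : ((1, 0) : ℤ × ℤ) ∈ S) (h01 : ((0, 1) : ℤ × ℤ) ∈ S)
    (h4 : ∀ a b c : ℤ × ℤ, ∃ z ∈ S, z ≠ a ∧ z ≠ b ∧ z ≠ c) :
    ((1, 1) : ℤ × ℤ) ∈ S ∨ ((-1, 1) : ℤ × ℤ) ∈ S ∨ ((1, -1) : ℤ × ℤ) ∈ S := by
  by_contra hcon
  push Not at hcon
  obtain ⟨hn1, hn2, hn3⟩ := hcon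
  by_cases hs : ∀ z ∈ S, 1 ≤ z.2 → z.1 + z.2 ≤ 1
  · exact hS.core h00 h10 h01 h4 hn1 hn2 hn3 hs
  by_cases hs' : ∀ z ∈ S, 1 ≤ z.1 → z.1 + z.2 ≤ 1
  · refine hS.swap.core h00 h01 h10 ?_ hn1 hn3 hn2 (fun z hz h => by have := hs' _ hz h; simp only at this; omega)
    intro a b c
    obtain ⟨z, hz, n1, n2, n3⟩ := h4 a.swap b.swap c.swap
    refine ⟨z.swap, hz, ?_, ?_, ?_⟩
    · rintro rfl; exact n1 (by simp)
    · rintro rfl; exact n2 (by simp)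
    · rintro rfl; exact n3 (by simp)
  push Not at hs hs'
  obtain ⟨u, hu, hu1, hu2⟩ := hs
  obtain ⟨v, hv, hv1, hv2⟩ := hs'
  have r : ∀ z ∈ S, ¬ (1 ≤ z.1 ∧ 1 ≤ z.2) := by
    rintro z hz ⟨h1, h2⟩
    apply hn1
    refine hS.conv3 _ _ _ _ (z.2 - 1) (z.1 - 1) 1 h10 h01 hz (by omega) (by omega) (by omega) (by omega) ?_ ?_
    · simp only; ring
    · simp only; ring
  have ru := r u hu
  have rv := r v hv
  apply hn1
  have m0 : 0 ≤ -u.1 := by omega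
  have n0 : 0 ≤ -v.2 := by omega
  have s0 : 0 ≤ u.1 + u.2 - 2 := by omega
  have t0 : 0 ≤ v.1 + v.2 - 2 := by omega
  have p1 : 0 < (v.1 + v.2 - 1) + (-v.2) := by omega
  have p2 : 0 < (u.1 + u.2 - 1) + (-u.1) := by omega
  have q1 := mul_nonneg p1.le s0
  have q2 := mul_nonneg p2.le t0
  refine hS.conv _ _ _ _ _ (((v.1 + v.2 - 1) + (-v.2)) * (u.1 + u.2 - 2)) ((v.1 + v.2 - 1) + (-v.2))
     (((u.1 + u.2 - 1) + (-u.1)) * (v.1 + v.2 - 2)) ((u.1 + u.2 - 1) + (-u.1)) h01 hu h10 hv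
     q1 p1.le q2 p2.le (by linarith) ?_ ?_
  · simp only; ring
  · simp only; ring

theorem Sm2.reflect {S : Set (ℤ × ℤ)} (hS : Sm2 S) (A B C : ℤ × ℤ) (hA : A ∈ S) (hB : B ∈ S) (hC : C ∈ S)
    (e : ℤ) (he : e * e = 1) (hd : (B.1 - A.1) * (C.2 - A.2) - (C.1 - A.1) * (B.2 - A.2) = e)
    (h4 : ∀ a b c : ℤ × ℤ, ∃ z ∈ S, z ≠ a ∧ z ≠ b ∧ z ≠ c) :
    B + C - A ∈ S ∨ A + C - B ∈ S ∨ A + B - C ∈ S := by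
  have hS' := hS.map (B.1 - A.1) (C.1 - A.1) (B.2 - A.2) (C.2 - A.2) A.1 A.2 e he hd
  have := hS'.reflect_std (by simpa using hA) (by simpa using hB) (by simpa using hC) (by
    intro a b c
    obtain ⟨z, hz, n1, n2, n3⟩ := h4
      ((B.1 - A.1) * a.1 + (C.1 - A.1) * a.2 + A.1, (B.2 - A.2) * a.1 + (C.2 - A.2) * a.2 + A.2)
      ((B.1 - A.1) * b.1 + (C.1 - A.1) * b.2 + A.1, (B.2 - A.2) * b.1 + (C.2 - A.2) * b.2 + A.2)
      ((B.1 - A.1) * c.1 + (C.1 - A.1) * c.2 + A.1, (B.2 - A.2) * c.1 + (C.2 - A.2) * c.2 + A.2)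
    have hz' : z = ((B.1 - A.1) * (e * ((C.2 - A.2) * (z.1 - A.1) - (C.1 - A.1) * (z.2 - A.2))) +
       (C.1 - A.1) * (e * (-(B.2 - A.2) * (z.1 - A.1) + (B.1 - A.1) * (z.2 - A.2))) + A.1,
       (B.2 - A.2) * (e * ((C.2 - A.2) * (z.1 - A.1) - (C.1 - A.1) * (z.2 - A.2))) +
       (C.2 - A.2) * (e * (-(B.2 - A.2) * (z.1 - A.1) + (B.1 - A.1) * (z.2 - A.2))) + A.2) := by
      ext
      · simp only
        linear_combination (-(z.1 - A.1)) * he - e * (z.1 - A.1) * hd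
      · simp only
        linear_combination (-(z.2 - A.2)) * he - e * (z.2 - A.2) * hd
    refine ⟨(e * ((C.2 - A.2) * (z.1 - A.1) - (C.1 - A.1) * (z.2 - A.2)),
      e * (-(B.2 - A.2) * (z.1 - A.1) + (B.1 - A.1) * (z.2 - A.2))), ?_, ?_, ?_, ?_⟩
    · rw [Set.mem_ofPred_eq, ← hz']; exact hz
    · rintro rfl; exact n1 hz'
    · rintro rfl; exact n2 hz'
    · rintro rfl; exact n3 hz')
  rcases this with h | h | h
  · left
    rw [Set.mem_ofPred_eq] at h
    convert h using 1
    ext <;> simp <;> ring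
  · right; left
    rw [Set.mem_ofPred_eq] at h
    convert h using 1
    ext <;> simp <;> ring
  · right; right
    rw [Set.mem_ofPred_eq] at h
    convert h using 1
    ext <;> simp <;> ring

/-- The point `y` lies in a lattice parallelogram with corners in `S`. -/
def Para (S : Set (ℤ × ℤ)) (y : ℝ × ℝ) : Prop :=
  ∃ C U W : ℤ × ℤ, C ∈ S ∧ C + U ∈ S ∧ C + W ∈ S ∧ C + U + W ∈ S ∧
    ∃ α β : ℝ, 0 ≤ α ∧ α ≤ 1 ∧ 0 ≤ β ∧ β ≤ 1 ∧
      y.1 = C.1 + α * U.1 + β * W.1 ∧ y.2 = C.2 + α * U.2 + β * W.2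

theorem exists_inner (A B C : ℤ × ℤ) (D : ℤ)
    (hD : (B.1 - A.1) * (C.2 - A.2) - (C.1 - A.1) * (B.2 - A.2) = D) (h0 : D ≠ 0) (h1 : ¬ D ∣ 1) :
    ∃ (z : ℤ × ℤ) (l0 l1 l2 : ℤ), 0 ≤ l0 ∧ 0 ≤ l1 ∧ 0 ≤ l2 ∧ l0 < |D| ∧ l1 < |D| ∧ l2 < |D| ∧
      l0 + l1 + l2 = |D| ∧ |D| * z.1 = l0 * A.1 + l1 * B.1 + l2 * C.1 ∧
      |D| * z.2 = l0 * A.2 + l1 * B.2 + l2 * C.2 := by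
  have hE : 0 < |D| := abs_pos.mpr h0
  -- an integer vector with non-integral coordinates
  have step1 : ∃ (m : ℤ × ℤ) (s t : ℤ), D * m.1 = s * (B.1 - A.1) + t * (C.1 - A.1) ∧
      D * m.2 = s * (B.2 - A.2) + t * (C.2 - A.2) ∧ ¬ (D ∣ s ∧ D ∣ t) := by
    by_contra hcon
    push Not at hcon
    have c1 := hcon (1, 0) (C.2 - A.2) (-(B.2 - A.2)) (by simp only; rw [← hD]; ring) (by simp only; ring)
    have c2 := hcon (0, 1) (-(C.1 - A.1)) (B.1 - A.1) (by simp only; ring) (by simp only; rw [← hD]; ring)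
    obtain ⟨⟨a, ha⟩, ⟨b, hb⟩⟩ := c1
    obtain ⟨⟨c, hc⟩, ⟨d, hd⟩⟩ := c2
    apply h1
    refine ⟨d * a - c * b, ?_⟩
    apply mul_left_cancel₀ h0
    have hc' : C.1 - A.1 = D * (-c) := by linarith
    have hb' : B.2 - A.2 = D * (-b) := by linarith
    rw [ha, hd, hc', hb'] at hD
    linarith
  have step2 : ∃ (m : ℤ × ℤ) (s t : ℤ), |D| * m.1 = s * (B.1 - A.1) + t * (C.1 - A.1) ∧
      |D| * m.2 = s * (B.2 - A.2) + t * (C.2 - A.2) ∧ ¬ (|D| ∣ s ∧ |D| ∣ t) := by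
    obtain ⟨m, s, t, e1, e2, h⟩ := step1
    rcases abs_choice D with hh | hh
    · rw [hh]; exact ⟨m, s, t, e1, e2, h⟩
    · refine ⟨m, -s, -t, ?_, ?_, ?_⟩
      · rw [hh]; linarith
      · rw [hh]; linarith
      · simpa using h
  obtain ⟨m, s, t, e1, e2, h⟩ := step2
  generalize |D| = E at *
  have s0 := Int.emod_nonneg s hE.ne'
  have t0 := Int.emod_nonneg t hE.ne'
  have s1 := Int.emod_lt_of_pos s hE
  have t1 := Int.emod_lt_of_pos t hE
  have sd := Int.emod_add_mul_ediv s E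
  have td := Int.emod_add_mul_ediv t E
  have hst : 0 < s % E + t % E := by
    by_contra hc
    exact h ⟨Int.dvd_of_emod_eq_zero (by omega), Int.dvd_of_emod_eq_zero (by omega)⟩
  generalize s % E = σ at *
  generalize t % E = τ at *
  generalize s / E = s' at *
  generalize t / E = t' at *
  subst sd td
  by_cases hle : σ + τ ≤ E
  · refine ⟨(A.1 + m.1 - s' * (B.1 - A.1) - t' * (C.1 - A.1), A.2 + m.2 - s' * (B.2 - A.2) - t' * (C.2 - A.2)),
      E - σ - τ, σ, τ, by omega, s0, t0, by omega, s1, t1, by ring, ?_, ?_⟩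
    · simp only; linear_combination e1
    · simp only; linear_combination e2
  · refine ⟨(B.1 + C.1 - A.1 - (m.1 - s' * (B.1 - A.1) - t' * (C.1 - A.1)),
      B.2 + C.2 - A.2 - (m.2 - s' * (B.2 - A.2) - t' * (C.2 - A.2))),
      σ + τ - E, E - σ, E - τ, by omega, by omega, by omega, by omega, by omega, by omega, by ring, ?_, ?_⟩
    · simp only; linear_combination -e1
    · simp only; linear_combination -e2

theorem ratio_choice (a b c l0 l1 l2 : ℝ) (ha : 0 ≤ a) (hb : 0 ≤ b) (hc : 0 ≤ c) (p0 : 0 ≤ l0) (p1 : 0 ≤ l1)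
    (p2 : 0 ≤ l2) (hs : 0 < l0 + l1 + l2) :
    (0 < l2 ∧ c * l0 ≤ a * l2 ∧ c * l1 ≤ b * l2) ∨ (0 < l1 ∧ b * l0 ≤ a * l1 ∧ b * l2 ≤ c * l1) ∨
          (0 < l0 ∧ a * l1 ≤ b * l0 ∧ a * l2 ≤ c * l0) := by
  have hx : ∀ i, 0 ≤ (![a, b, c] : Fin 3 → ℝ) i := by intro i; fin_cases i <;> simpa
  have hl : ∀ i, 0 ≤ (![l0, l1, l2] : Fin 3 → ℝ) i := by intro i; fin_cases i <;> simpa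
  have hne : (Finset.univ.filter (fun i => 0 < (![l0, l1, l2] : Fin 3 → ℝ) i)).Nonempty := by
    by_contra hcon
    rw [Finset.not_nonempty_iff_eq_empty, Finset.filter_eq_empty_iff] at hcon
    have h0 := @hcon 0 (Finset.mem_univ _)
    have h1 := @hcon 1 (Finset.mem_univ _)
    have h2 := @hcon 2 (Finset.mem_univ _)
    simp at h0 h1 h2
    linarith
  obtain ⟨i, hi, hmin⟩ := Finset.exists_min_image _
    (fun i => (![a, b, c] : Fin 3 → ℝ) i / (![l0, l1, l2] : Fin 3 → ℝ) i) hne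
  have hi' := (Finset.mem_filter.mp hi).2
  have key : ∀ j, (![a, b, c] : Fin 3 → ℝ) i * (![l0, l1, l2] : Fin 3 → ℝ) j ≤
      (![a, b, c] : Fin 3 → ℝ) j * (![l0, l1, l2] : Fin 3 → ℝ) i := by
    intro j
    rcases (hl j).eq_or_lt with h | h
    · rw [← h]; have := mul_nonneg (hx j) (hl i); linarith
    · have := hmin j (by simp only [Finset.mem_filter, Finset.mem_univ, true_and]; exact h)
      rwa [div_le_div_iff₀ hi' h] at this
  clear hmin hi hne hl hx
  have k0 := key 0
  have k1 := key 1
  have k2 := key 2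
  clear key
  fin_cases i <;> simp at hi' k0 k1 k2
  · right; right; exact ⟨hi', k1, k2⟩
  · right; left; exact ⟨hi', k0, k2⟩
  · left; exact ⟨hi', k0, k1⟩

theorem Sm2.tri {S : Set (ℤ × ℤ)} (hS : Sm2 S) (h4 : ∀ a b c : ℤ × ℤ, ∃ z ∈ S, z ≠ a ∧ z ≠ b ∧ z ≠ c) (N : ℕ) :
    ∀ (A B C : ℤ × ℤ), A ∈ S → B ∈ S → C ∈ S →
    (B.1 - A.1) * (C.2 - A.2) - (C.1 - A.1) * (B.2 - A.2) ≠ 0 →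
    |(B.1 - A.1) * (C.2 - A.2) - (C.1 - A.1) * (B.2 - A.2)| ≤ N →
    ∀ (y : ℝ × ℝ) (a b c : ℝ), 0 ≤ a → 0 ≤ b → 0 ≤ c → a + b + c = 1 →
    y.1 = a * A.1 + b * B.1 + c * C.1 → y.2 = a * A.2 + b * B.2 + c * C.2 → Para S y := by
  induction N with
  | zero =>
    intro A B C _ _ _ h0 h1
    exact absurd (abs_nonpos_iff.mp (by simpa using h1)) h0
  | succ N ih =>
    intro A B C hA hB hC h0 hN y a b c ha hb hc habc e1 e2
    obtain ⟨D, hD⟩ : ∃ D, (B.1 - A.1) * (C.2 - A.2) - (C.1 - A.1) * (B.2 - A.2) = D := ⟨_, rfl⟩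
    rw [hD] at h0 hN
    by_cases h1 : D ∣ 1
    · have he : D * D = 1 := by
        rcases Int.isUnit_iff.mp (isUnit_of_dvd_one h1) with h | h <;> rw [h] <;> norm_num
      rcases hS.reflect A B C hA hB hC D he hD h4 with h | h | h
      · refine ⟨A, B - A, C - A, hA, by simpa using hB, by simpa using hC, by convert h using 1; abel, b, c, hb, by linarith, hc, by linarith, ?_, ?_⟩
        · rw [e1]; push_cast [Prod.fst_sub]; linear_combination (A.1 : ℝ) * habc
        · rw [e2]; push_cast [Prod.snd_sub]; linear_combination (A.2 : ℝ) * habc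
      · refine ⟨B, A - B, C - B, hB, by simpa using hA, by simpa using hC, by convert h using 1; abel, a, c, ha, by linarith, hc, by linarith, ?_, ?_⟩
        · rw [e1]; push_cast [Prod.fst_sub]; linear_combination (B.1 : ℝ) * habc
        · rw [e2]; push_cast [Prod.snd_sub]; linear_combination (B.2 : ℝ) * habc
      · refine ⟨C, A - C, B - C, hC, by simpa using hA, by simpa using hB, by convert h using 1; abel, a, b, ha, by linarith, hb, by linarith, ?_, ?_⟩
        · rw [e1]; push_cast [Prod.fst_sub]; linear_combination (C.1 : ℝ) * habc
        · rw [e2]; push_cast [Prod.snd_sub]; linear_combination (C.2 : ℝ) * habc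
    · obtain ⟨z, l0, l1, l2, p0, p1, p2, q0, q1, q2, hsum, z1, z2⟩ := exists_inner A B C D hD h0 h1
      have hE : 0 < |D| := abs_pos.mpr h0
      have hz : z ∈ S := by
        refine hS.conv z A B C C l0 l1 l2 0 hA hB hC hC p0 p1 p2 le_rfl (by omega) ?_ ?_
        · linear_combination (z.1) * hsum + z1
        · linear_combination (z.2) * hsum + z2
      -- replacement of one corner
      have key : ∀ (A B C : ℤ × ℤ) (a b c : ℝ) (l0 l1 l2 : ℤ), A ∈ S → B ∈ S →
          |(B.1 - A.1) * (C.2 - A.2) - (C.1 - A.1) * (B.2 - A.2)| = |D| →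
          0 ≤ c → a + b + c = 1 →
          0 < l2 → l2 < |D| → l0 + l1 + l2 = |D| → c * l0 ≤ a * l2 → c * l1 ≤ b * l2 →
          |D| * z.1 = l0 * A.1 + l1 * B.1 + l2 * C.1 → |D| * z.2 = l0 * A.2 + l1 * B.2 + l2 * C.2 →
          y.1 = a * A.1 + b * B.1 + c * C.1 → y.2 = a * A.2 + b * B.2 + c * C.2 → Para S y := by
        clear z1 z2 hsum p0 p1 p2 q0 q1 q2 l0 l1 l2 e1 e2 habc ha hb hc a b c hD hA hB hC A B C
        intro A B C a b c l0 l1 l2 hA hB hD hc habc p2 q2 hsum r0 r1 z1 z2 e1 e2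
        have hdet : |D| * ((B.1 - A.1) * (z.2 - A.2) - (z.1 - A.1) * (B.2 - A.2)) =
            l2 * ((B.1 - A.1) * (C.2 - A.2) - (C.1 - A.1) * (B.2 - A.2)) := by
          linear_combination (B.1 - A.1) * z2 - (B.2 - A.2) * z1 + ((B.1 - A.1) * A.2 - A.1 * (B.2 - A.2)) * hsum
        have habs : |(B.1 - A.1) * (z.2 - A.2) - (z.1 - A.1) * (B.2 - A.2)| = l2 := by
          have h := congrArg abs hdet
          rw [abs_mul, abs_mul, abs_abs, hD, abs_of_pos p2, mul_comm l2] at h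
          exact mul_left_cancel₀ hE.ne' h
        have p2' : (0 : ℝ) < l2 := by exact_mod_cast p2
        have z1' : ((|D| : ℤ) : ℝ) * z.1 = l0 * A.1 + l1 * B.1 + l2 * C.1 := by exact_mod_cast z1
        have z2' : ((|D| : ℤ) : ℝ) * z.2 = l0 * A.2 + l1 * B.2 + l2 * C.2 := by exact_mod_cast z2
        have hs' : (l0 : ℝ) + l1 + l2 = ((|D| : ℤ) : ℝ) := by exact_mod_cast hsum
        have hE' : (0 : ℝ) < ((|D| : ℤ) : ℝ) := by exact_mod_cast hE
        refine ih A B z hA hB hz ?_ ?_ y (a - c * l0 / l2) (b - c * l1 / l2) (c * ((|D| : ℤ) : ℝ) / l2) ?_ ?_ ?_ ?_ ?_ ?_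
        · intro h; rw [h] at habs; simp at habs; omega
        · rw [habs]; push_cast at hN; omega
        · rw [sub_nonneg, div_le_iff₀ p2']; exact r0
        · rw [sub_nonneg, div_le_iff₀ p2']; exact r1
        · positivity
        · rw [← hs']; field_simp; linear_combination (l2 : ℝ) * habc
        · rw [e1]; field_simp; linear_combination -c * z1'
        · rw [e2]; field_simp; linear_combination -c * z2'
      have p0' : (0 : ℝ) ≤ l0 := by exact_mod_cast p0
      have p1' : (0 : ℝ) ≤ l1 := by exact_mod_cast p1
      have p2' : (0 : ℝ) ≤ l2 := by exact_mod_cast p2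
      have choice : (0 < l2 ∧ c * l0 ≤ a * l2 ∧ c * l1 ≤ b * l2) ∨ (0 < l1 ∧ b * l0 ≤ a * l1 ∧ b * l2 ≤ c * l1) ∨
          (0 < l0 ∧ a * l1 ≤ b * l0 ∧ a * l2 ≤ c * l0) := by
        have := ratio_choice a b c l0 l1 l2 ha hb hc p0' p1' p2' (by
          have : (0 : ℝ) < ((l0 + l1 + l2 : ℤ) : ℝ) := by rw [hsum]; exact_mod_cast hE
          push_cast at this; exact this)
        simpa using this
      rcases choice with ⟨h, r0, r1⟩ | ⟨h, r0, r1⟩ | ⟨h, r0, r1⟩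
      · exact key A B C a b c l0 l1 l2 hA hB (by rw [hD]) hc habc h q2 hsum r0 r1 z1 z2 e1 e2
      · refine key A C B a c b l0 l2 l1 hA hC (by rw [← hD, ← abs_neg]; congr 1; ring) hb (by linarith) h q1 (by linarith) r0 r1 (by linarith) (by linarith) (by linarith) (by linarith)
      · refine key B C A b c a l1 l2 l0 hB hC (by rw [← hD]; congr 1; ring) ha (by linarith) h q0 (by linarith) r0 r1 (by linarith) (by linarith) (by linarith) (by linarith)

/-- Cast of an integer pair. -/
def c2 (z : ℤ × ℤ) : ℝ × ℝ := ((z.1 : ℝ), (z.2 : ℝ))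

theorem Sm2.seg {S : Set (ℤ × ℤ)} (A B : ℤ × ℤ) (hA : A ∈ S) (hB : B ∈ S) (y : ℝ × ℝ) (a b : ℝ) (ha : 0 ≤ a) (hb : 0 ≤ b)
    (hab : a + b = 1) (e1 : y.1 = a * A.1 + b * B.1) (e2 : y.2 = a * A.2 + b * B.2) : Para S y := by
  refine ⟨A, B - A, 0, hA, by simpa using hB, by simpa using hA, by simpa using hB, b, 0, hb, by linarith, le_rfl, by norm_num, ?_, ?_⟩
  · rw [e1]; push_cast [Prod.fst_sub]; simp; linear_combination (A.1 : ℝ) * hab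
  · rw [e2]; push_cast [Prod.snd_sub]; simp; linear_combination (A.2 : ℝ) * hab

theorem Sm2.cover {S : Set (ℤ × ℤ)} (hS : Sm2 S) (h4 : ∀ a b c : ℤ × ℤ, ∃ z ∈ S, z ≠ a ∧ z ≠ b ∧ z ≠ c)
    (y : ℝ × ℝ) (hy : y ∈ convexHull ℝ (c2 '' S)) : Para S y := by
  obtain ⟨ι, hι, z, w, hz, hind, hw, hw1, hwy⟩ := eq_pos_convex_span_of_mem_convexHull hy
  have hcard : Fintype.card ι ≤ 3 := by
    have := hind.card_le_finrank_succ
    have h2 := Submodule.finrank_le (vectorSpan ℝ (Set.range z))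
    have h3 : Module.finrank ℝ (ℝ × ℝ) = 2 := by simp
    omega
  have hz' : ∀ i, ∃ p ∈ S, c2 p = z i := fun i => hz ⟨i, rfl⟩
  choose p hp hpz using hz'
  obtain ⟨e⟩ : Nonempty (Fin (Fintype.card ι) ≃ ι) := ⟨(Fintype.equivFin ι).symm⟩
  generalize Fintype.card ι = k at *
  rw [← e.sum_comp] at hw1 hwy
  have hind' := hind.comp_embedding e.toEmbedding
  subst hwy
  interval_cases k
  · simp at hw1
  · simp only [Finset.univ_unique, Fin.default_eq_zero, Finset.sum_singleton, ← hpz, c2] at hw1 ⊢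
    exact Sm2.seg (p (e 0)) (p (e 0)) (hp _) (hp _) _ 1 0 (by norm_num) (by norm_num) (by norm_num) (by simp [hw1]) (by simp [hw1])
  · simp only [Fin.sum_univ_two, ← hpz, c2] at hw1 ⊢
    exact Sm2.seg (p (e 0)) (p (e 1)) (hp _) (hp _) _ _ _ (hw _).le (hw _).le hw1 (by simp) (by simp)
  · rw [affineIndependent_iff] at hind'
    have key : ∀ a b c : ℝ, a + b + c = 0 → a * (p (e 0)).1 + b * (p (e 1)).1 + c * (p (e 2)).1 = 0 →
        a * (p (e 0)).2 + b * (p (e 1)).2 + c * (p (e 2)).2 = 0 → a = 0 ∧ b = 0 ∧ c = 0 := by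
      intro a b c h0 h1 h2
      have := hind' Finset.univ ![a, b, c] (by simp [Fin.sum_univ_three]; linarith) (by
        simp only [Fin.sum_univ_three, Function.comp, Equiv.coe_toEmbedding, ← hpz, c2]
        ext
        · simp; linarith
        · simp; linarith)
      exact ⟨this 0 (Finset.mem_univ _), this 1 (Finset.mem_univ _), this 2 (Finset.mem_univ _)⟩
    simp only [Fin.sum_univ_three, ← hpz, c2] at hw1 ⊢
    refine hS.tri h4 _ (p (e 0)) (p (e 1)) (p (e 2)) (hp _) (hp _) (hp _) ?_ (by rw [Int.abs_eq_natAbs]) _ _ _ _ (hw _).le (hw _).le (hw _).le hw1 (by simp) (by simp)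
    generalize p (e 0) = A at *
    generalize p (e 1) = B at *
    generalize p (e 2) = C at *
    intro hdet
    have hdet' : ((B.1 : ℝ) - A.1) * (C.2 - A.2) - (C.1 - A.1) * (B.2 - A.2) = 0 := by exact_mod_cast hdet
    have k1 := key ((B.1 - A.1) - (C.1 - A.1)) (C.1 - A.1) (-(B.1 - A.1)) (by ring) (by ring) (by linear_combination -hdet')
    have k2 := key ((B.2 - A.2) - (C.2 - A.2)) (C.2 - A.2) (-(B.2 - A.2)) (by ring) (by linear_combination hdet') (by ring)
    have := key (-1) 1 0 (by ring) (by linarith [k1.2.2]) (by linarith [k2.2.2])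
    linarith [this.1]

/-- Cast of an integer triple. -/
def c3 (z : ℤ × ℤ × ℤ) : ℝ × ℝ × ℝ := ((z.1 : ℝ), (z.2.1 : ℝ), (z.2.2 : ℝ))

/-- Generators at a vertex. -/
def Gen3 (S : Set (ℤ × ℤ × ℤ)) (w a b c : ℤ × ℤ × ℤ) : Prop :=
  w + a ∈ S ∧ w + b ∈ S ∧ w + c ∈ S ∧ ∀ z ∈ S, ∃ i j k : ℤ, 0 ≤ i ∧ 0 ≤ j ∧ 0 ≤ k ∧
    z.1 = w.1 + i * a.1 + j * b.1 + k * c.1 ∧ z.2.1 = w.2.1 + i * a.2.1 + j * b.2.1 + k * c.2.1 ∧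
    z.2.2 = w.2.2 + i * a.2.2 + j * b.2.2 + k * c.2.2

theorem Gen3.swap {S : Set (ℤ × ℤ × ℤ)} {w a b c : ℤ × ℤ × ℤ} (h : Gen3 S w a b c) : Gen3 S w a c b := by
  obtain ⟨ha, hb, hc, hall⟩ := h
  refine ⟨ha, hc, hb, fun z hz => ?_⟩
  obtain ⟨i, j, k, hi, hj, hk, e1, e2, e3⟩ := hall z hz
  exact ⟨i, k, j, hi, hk, hj, by linarith, by linarith, by linarith⟩

theorem Gen3.rot {S : Set (ℤ × ℤ × ℤ)} {w a b c : ℤ × ℤ × ℤ} (h : Gen3 S w a b c) : Gen3 S w b c a := by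
  obtain ⟨ha, hb, hc, hall⟩ := h
  refine ⟨hb, hc, ha, fun z hz => ?_⟩
  obtain ⟨i, j, k, hi, hj, hk, e1, e2, e3⟩ := hall z hz
  exact ⟨j, k, i, hj, hk, hi, by linarith, by linarith, by linarith⟩

/-- The situation around a vertex of the polytope, in adapted coordinates. -/
structure Core (S : Set (ℤ × ℤ × ℤ)) (K : Set (ℝ × ℝ × ℝ)) (c : ℤ × ℤ × ℤ) : Prop where
  fin : S.Finite
  hull : K = convexHull ℝ (c3 '' S)
  sat : ∀ z, c3 z ∈ K → z ∈ S
  smooth : ∀ w ∈ S, ∀ p q r : ℤ,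
    (∀ z ∈ S, z ≠ w → p * z.1 + q * z.2.1 + r * z.2.2 < p * w.1 + q * w.2.1 + r * w.2.2) →
    ∃ a b c : ℤ × ℤ × ℤ, Gen3 S w a b c
  nn : ∀ z ∈ S, 0 ≤ z.1 ∧ 0 ≤ z.2.1 ∧ 0 ≤ z.2.2
  h000 : (0, 0, 0) ∈ S
  h100 : (1, 0, 0) ∈ S
  h010 : (0, 1, 0) ∈ S
  h001 : (0, 0, 1) ∈ S
  sym : ∀ z ∈ S, c + c - z ∈ S

theorem Core.mem {S K c} (h : Core S K c) {z : ℤ × ℤ × ℤ} (hz : z ∈ S) : c3 z ∈ K := by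
  rw [h.hull]; exact subset_convexHull ℝ _ ⟨z, hz, rfl⟩

theorem Core.convex {S K c} (h : Core S K c) : Convex ℝ K := by
  rw [h.hull]; exact convex_convexHull ℝ _

theorem Core.face_vertex {S K c} (h : Core S K c) (w : ℤ × ℤ) (hw : (w.1, w.2, 0) ∈ S) (p q : ℤ)
    (hmax : ∀ z : ℤ × ℤ, (z.1, z.2, 0) ∈ S → z ≠ w → p * z.1 + q * z.2 < p * w.1 + q * w.2) :
    ∃ f g u : ℤ × ℤ, (w.1 + f.1, w.2 + f.2, 0) ∈ S ∧ (w.1 + g.1, w.2 + g.2, 0) ∈ S ∧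
      (w.1 + u.1, w.2 + u.2, 1) ∈ S ∧ ∀ z ∈ S, ∃ i j : ℤ, 0 ≤ i ∧ 0 ≤ j ∧
      z.1 = w.1 + i * f.1 + j * g.1 + z.2.2 * u.1 ∧ z.2.1 = w.2 + i * f.2 + j * g.2 + z.2.2 * u.2 := by
  obtain ⟨b, hb, hbmax⟩ := Set.exists_max_image S (fun z => p * z.1 + q * z.2.1) h.fin ⟨_, hw⟩
  have hb0 := hbmax _ hw
  simp only at hb0 hbmax
  obtain ⟨M, hM⟩ : ∃ M, M = p * b.1 + q * b.2.1 - (p * w.1 + q * w.2) + 1 := ⟨_, rfl⟩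
  obtain ⟨a1, a2, a3, hG⟩ := h.smooth _ hw p q (-M) (by
    rintro ⟨z1, z2, z3⟩ hz hne
    simp only
    have h3 : 0 ≤ z3 := (h.nn _ hz).2.2
    rcases h3.eq_or_lt with h0 | h0
    · subst h0
      have := hmax (z1, z2) hz (by rintro rfl; exact hne rfl)
      simp only at this
      linarith
    · have h1 := hbmax _ hz
      simp only at h1
      have h2 : M * 1 ≤ M * z3 := mul_le_mul_of_nonneg_left (by omega) (by omega)
      linarith)
  have nn3 : ∀ {a b c}, Gen3 S (w.1, w.2, 0) a b c → 0 ≤ a.2.2 := by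
    intro a b c hG
    have := (h.nn _ hG.1).2.2
    simpa using this
  have neg : ∀ a b c, Gen3 S (w.1, w.2, 0) a b c → 0 < a.2.2 → 0 < b.2.2 → False := by
    intro a b c hG ha hb
    have hc := nn3 hG.rot.rot
    have h0 : ∀ x y : ℤ, (x, y, 0) ∈ S → ∃ k : ℤ, x = w.1 + k * c.1 ∧ y = w.2 + k * c.2.1 := by
      intro x y hxy
      obtain ⟨i, j, k, hi, hj, hk, e1, e2, e3⟩ := hG.2.2.2 _ hxy
      simp only at e1 e2 e3
      have m1 := mul_nonneg hi ha.le
      have m2 := mul_nonneg hj hb.le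
      have m3 := mul_nonneg hk hc
      have i0 : i = 0 := (mul_eq_zero.mp (by linarith : i * a.2.2 = 0)).resolve_right ha.ne'
      have j0 : j = 0 := (mul_eq_zero.mp (by linarith : j * b.2.2 = 0)).resolve_right hb.ne'
      subst i0 j0
      exact ⟨k, by linarith, by linarith⟩
    obtain ⟨k1, p1, q1⟩ := h0 0 0 h.h000
    obtain ⟨k2, p2, q2⟩ := h0 1 0 h.h100
    obtain ⟨k3, p3, q3⟩ := h0 0 1 h.h010
    have : (1 : ℤ) = 0 := by
      have r1 : (k2 - k1) * c.1 = 1 := by linarith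
      have r2 : (k2 - k1) * c.2.1 = 0 := by linarith
      have r3 : (k3 - k1) * c.2.1 = 1 := by linarith
      rcases mul_eq_zero.mp r2 with h | h
      · rw [h] at r1; linarith
      · rw [h] at r3; linarith
    omega
  have pos : ∀ a b c, Gen3 S (w.1, w.2, 0) a b c → a.2.2 = 0 → b.2.2 = 0 →
      ∃ f g u : ℤ × ℤ, (w.1 + f.1, w.2 + f.2, 0) ∈ S ∧ (w.1 + g.1, w.2 + g.2, 0) ∈ S ∧
      (w.1 + u.1, w.2 + u.2, 1) ∈ S ∧ ∀ z ∈ S, ∃ i j : ℤ, 0 ≤ i ∧ 0 ≤ j ∧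
      z.1 = w.1 + i * f.1 + j * g.1 + z.2.2 * u.1 ∧ z.2.1 = w.2 + i * f.2 + j * g.2 + z.2.2 * u.2 := by
    intro a b c hG ha hb
    have hc := nn3 hG.rot.rot
    obtain ⟨g1, g2, g3, hall⟩ := hG
    have hc1 : c.2.2 = 1 := by
      obtain ⟨i, j, k, hi, hj, hk, e1, e2, e3⟩ := hall _ h.h001
      simp only [ha, hb] at e3
      exact Int.eq_one_of_dvd_one hc ⟨k, by linarith⟩
    refine ⟨(a.1, a.2.1), (b.1, b.2.1), (c.1, c.2.1), ?_, ?_, ?_, ?_⟩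
    · convert g1 using 1; ext <;> simp [ha]
    · convert g2 using 1; ext <;> simp [hb]
    · convert g3 using 1; ext <;> simp [hc1]
    · intro z hz
      obtain ⟨i, j, k, hi, hj, hk, e1, e2, e3⟩ := hall _ hz
      simp only [ha, hb, hc1] at e1 e2 e3
      have : z.2.2 = k := by linarith
      refine ⟨i, j, hi, hj, ?_, ?_⟩
      · rw [this]; exact e1
      · rw [this]; exact e2
  rcases (nn3 hG).eq_or_lt with h1 | h1
  · rcases (nn3 hG.rot).eq_or_lt with h2 | h2
    · exact pos _ _ _ hG h1.symm h2.symm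
    · rcases (nn3 hG.rot.rot).eq_or_lt with h3 | h3
      · exact pos _ _ _ hG.swap h1.symm h3.symm
      · exact (neg _ _ _ hG.rot h2 h3).elim
  · rcases (nn3 hG.rot).eq_or_lt with h2 | h2
    · rcases (nn3 hG.rot.rot).eq_or_lt with h3 | h3
      · exact pos _ _ _ hG.rot h2.symm h3.symm
      · exact (neg _ _ _ hG.swap h1 h3).elim
    · exact (neg _ _ _ hG h1 h2).elim

theorem c3_comb4 {K : Set (ℝ × ℝ × ℝ)} (hK : Convex ℝ K) {a b c d z : ℝ × ℝ × ℝ} (ha : a ∈ K) (hb : b ∈ K)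
    (hc : c ∈ K) (hd : d ∈ K) {i j k l : ℝ} (hi : 0 ≤ i) (hj : 0 ≤ j) (hk : 0 ≤ k) (hl : 0 ≤ l)
    (hs : 0 < i + j + k + l) (e1 : (i + j + k + l) * z.1 = i * a.1 + j * b.1 + k * c.1 + l * d.1)
    (e2 : (i + j + k + l) * z.2.1 = i * a.2.1 + j * b.2.1 + k * c.2.1 + l * d.2.1)
    (e3 : (i + j + k + l) * z.2.2 = i * a.2.2 + j * b.2.2 + k * c.2.2 + l * d.2.2) : z ∈ K := by
  have := hK.sum_mem (t := Finset.univ) (w := ![i / (i + j + k + l), j / (i + j + k + l), k / (i + j + k + l), l / (i + j + k + l)])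
    (z := ![a, b, c, d]) (by
      intro x _; fin_cases x <;> simp <;> positivity) (by
      simp [Fin.sum_univ_four]; field_simp) (by
      intro x _; fin_cases x <;> simpa)
  convert this using 1
  generalize hs' : i + j + k + l = s at *
  have hs0 := hs.ne'
  simp only [Fin.sum_univ_four]
  ext
  · simp; field_simp; linarith
  · simp; field_simp; linarith
  · simp; field_simp; linarith

theorem Core.sm2 {S K c} (h : Core S K c) : Sm2 {z : ℤ × ℤ | (z.1, z.2, 0) ∈ S} := by
  refine ⟨?_, ?_, ?_⟩
  · apply Set.Finite.preimage _ h.fin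
    intro x _ y _ hxy
    simp only [Prod.mk.injEq] at hxy
    exact Prod.ext hxy.1 hxy.2.1
  · intro z a b c d i j k l ha hb hc hd hi hj hk hl hs e1 e2
    apply h.sat
    refine c3_comb4 h.convex (h.mem ha) (h.mem hb) (h.mem hc) (h.mem hd) (i := i) (j := j) (k := k) (l := l)
      (by exact_mod_cast hi) (by exact_mod_cast hj) (by exact_mod_cast hk) (by exact_mod_cast hl) (by exact_mod_cast hs) ?_ ?_ ?_
    · simp only [c3]; exact_mod_cast e1
    · simp only [c3]; exact_mod_cast e2
    · simp [c3]
  · intro w hw p q hmax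
    obtain ⟨f, g, u, hf, hg, hu, hall⟩ := h.face_vertex w hw p q hmax
    refine ⟨f, g, hf, hg, ?_⟩
    intro z hz
    obtain ⟨i, j, hi, hj, e1, e2⟩ := hall _ hz
    exact ⟨i, j, hi, hj, by simpa using e1, by simpa using e2⟩

theorem Core.face_hull {S K c} (h : Core S K c) (y : ℝ × ℝ × ℝ) (hy : y ∈ K) (h0 : y.2.2 = 0) :
    (y.1, y.2.1) ∈ convexHull ℝ (c2 '' {z : ℤ × ℤ | (z.1, z.2, 0) ∈ S}) := by
  rw [h.hull] at hy
  obtain ⟨ι, hι, z, w, hz, -, hw, hw1, hwy⟩ := eq_pos_convex_span_of_mem_convexHull hy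
  have hz' : ∀ i, ∃ p ∈ S, c3 p = z i := fun i => hz ⟨i, rfl⟩
  choose p hp hpz using hz'
  have e3 : ∑ i, w i * ((p i).2.2 : ℝ) = 0 := by
    rw [← h0, ← hwy, Prod.snd_sum, Prod.snd_sum]
    refine Finset.sum_congr rfl fun i _ => ?_
    rw [← hpz]; simp [c3]
  rw [Finset.sum_eq_zero_iff_of_nonneg] at e3
  · have hp0 : ∀ i, (p i).2.2 = 0 := by
      intro i
      have := e3 i (Finset.mem_univ _)
      rcases mul_eq_zero.mp this with h | h
      · exact absurd h (hw i).ne'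
      · exact_mod_cast h
    have : (y.1, y.2.1) = ∑ i, w i • c2 ((p i).1, (p i).2.1) := by
      rw [← hwy]
      ext
      · simp only [Prod.fst_sum]; refine Finset.sum_congr rfl fun i _ => ?_
        rw [← hpz]; simp [c3, c2]
      · simp only [Prod.snd_sum, Prod.fst_sum]; refine Finset.sum_congr rfl fun i _ => ?_
        rw [← hpz]; simp [c3, c2]
    rw [this]
    refine (convex_convexHull ℝ _).sum_mem (fun i _ => (hw i).le) hw1 (fun i _ => subset_convexHull ℝ _ ⟨_, ?_, rfl⟩)
    have := hp i
    have h1 := hp0 i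
    simp only [Set.mem_ofPred_eq]
    rw [← h1]; exact this
  · intro i _
    have := (h.nn _ (hp i)).2.2
    have h2 : (0 : ℝ) ≤ ((p i).2.2 : ℝ) := by exact_mod_cast this
    exact mul_nonneg (hw i).le h2

theorem c3_add (a b : ℤ × ℤ × ℤ) : c3 (a + b) = c3 a + c3 b := by simp [c3]
theorem c3_sub (a b : ℤ × ℤ × ℤ) : c3 (a - b) = c3 a - c3 b := by simp [c3]

theorem box_mem {E : Type*} [AddCommGroup E] [Module ℝ E] {K : Set E} (hK : Convex ℝ K) {C U V W : E}
    (h0 : C ∈ K) (hU : C + U ∈ K) (hV : C + V ∈ K) (hUV : C + U + V ∈ K) (hW : C + W ∈ K) (hUW : C + U + W ∈ K)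
    (hVW : C + V + W ∈ K) (hUVW : C + U + V + W ∈ K) {α β γ : ℝ} (hα : α ∈ Icc (0 : ℝ) 1)
    (hβ : β ∈ Icc (0 : ℝ) 1) (hγ : γ ∈ Icc (0 : ℝ) 1) : C + α • U + β • V + γ • W ∈ K := by
  have b : ∀ {D : E}, D ∈ K → D + U ∈ K → D + V ∈ K → D + U + V ∈ K → D + α • U + β • V ∈ K := by
    intro D h1 h2 h3 h4
    apply hK.add_smul_mem (hK.add_smul_mem h1 h2 hα) _ hβ
    have := hK.add_smul_mem h3 (by rw [add_right_comm]; exact h4) hα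
    rwa [add_right_comm]
  apply hK.add_smul_mem (b h0 hU hV hUV) _ hγ
  have := b hW (by rw [add_right_comm]; exact hUW) (by rw [add_right_comm]; exact hVW) (by
    rw [add_right_comm C W U, add_right_comm _ W V]; exact hUVW)
  convert this using 1
  abel

/-- The reduction step. -/
def StepAt (S : Set (ℤ × ℤ × ℤ)) (K : Set (ℝ × ℝ × ℝ)) (n : ℝ) (p : ℤ × ℤ × ℤ) : Prop :=
  ∃ q ∈ S, ∃ z ∈ K, c3 p - c3 q = (n - 1) • z

theorem eps_choice {n t : ℝ} (hn : 2 ≤ n) (h0 : 0 ≤ t) (h1 : t ≤ n) : ∃ ε : ℤ, (ε = 0 ∨ ε = 1) ∧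
    (t - ε) / (n - 1) ∈ Icc (0 : ℝ) 1 := by
  have hn' : 0 < n - 1 := by linarith
  by_cases h : 1 ≤ t
  · refine ⟨1, Or.inr rfl, div_nonneg (by push_cast; linarith) hn'.le, ?_⟩
    rw [div_le_one hn']; push_cast; linarith
  · refine ⟨0, Or.inl rfl, div_nonneg (by push_cast; linarith) hn'.le, ?_⟩
    rw [div_le_one hn']; push_cast; linarith

theorem Core.box_step {S K c} (h : Core S K c) {C U V W : ℤ × ℤ × ℤ}
    (h0 : C ∈ S) (hU : C + U ∈ S) (hV : C + V ∈ S) (hUV : C + U + V ∈ S) (hW : C + W ∈ S) (hUW : C + U + W ∈ S)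
    (hVW : C + V + W ∈ S) (hUVW : C + U + V + W ∈ S) {α β γ : ℝ} (hα : α ∈ Icc (0 : ℝ) 1)
    (hβ : β ∈ Icc (0 : ℝ) 1) (hγ : γ ∈ Icc (0 : ℝ) 1) {n : ℝ} (hn : 2 ≤ n) {p : ℤ × ℤ × ℤ}
    (hp : c3 p = n • (c3 C + α • c3 U + β • c3 V + γ • c3 W)) : StepAt S K n p := by
  have bd : ∀ {t : ℝ}, t ∈ Icc (0 : ℝ) 1 → 0 ≤ n * t ∧ n * t ≤ n := by
    intro t ht
    exact ⟨mul_nonneg (by linarith) ht.1, by nlinarith [ht.2]⟩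
  obtain ⟨ε₁, hε₁, r₁⟩ := eps_choice hn (bd hα).1 (bd hα).2
  obtain ⟨ε₂, hε₂, r₂⟩ := eps_choice hn (bd hβ).1 (bd hβ).2
  obtain ⟨ε₃, hε₃, r₃⟩ := eps_choice hn (bd hγ).1 (bd hγ).2
  refine ⟨C + ε₁ • U + ε₂ • V + ε₃ • W, ?_, _, box_mem h.convex (C := c3 C) (U := c3 U) (V := c3 V) (W := c3 W) (h.mem h0) ?_ ?_ ?_ ?_ ?_ ?_ ?_ r₁ r₂ r₃, ?_⟩
  · rcases hε₁ with rfl | rfl <;> rcases hε₂ with rfl | rfl <;> rcases hε₃ with rfl | rfl <;>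
      simpa only [zero_smul, one_smul, add_zero]
  · rw [← c3_add]; exact h.mem hU
  · rw [← c3_add]; exact h.mem hV
  · rw [← c3_add, ← c3_add]; exact h.mem hUV
  · rw [← c3_add]; exact h.mem hW
  · rw [← c3_add, ← c3_add]; exact h.mem hUW
  · rw [← c3_add, ← c3_add]; exact h.mem hVW
  · rw [← c3_add, ← c3_add, ← c3_add]; exact h.mem hUVW
  · have hn' : n - 1 ≠ 0 := by linarith
    rw [hp]
    ext
    · simp [c3]; field_simp; ring
    · simp [c3]; field_simp; ring
    · simp [c3]; field_simp; ring

theorem Core.para_step {S K c} (h : Core S K c) {C U V : ℤ × ℤ × ℤ}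
    (h0 : C ∈ S) (hU : C + U ∈ S) (hV : C + V ∈ S) (hUV : C + U + V ∈ S) {α β l : ℝ} (hα : α ∈ Icc (0 : ℝ) 1)
    (hβ : β ∈ Icc (0 : ℝ) 1) (hl : l ∈ Icc (0 : ℝ) 1) {n : ℝ} (hn : 2 ≤ n) {p : ℤ × ℤ × ℤ}
    (hp : c3 p = n • (l • (c3 C + α • c3 U + β • c3 V) + (1 - l) • c3 c)) : StepAt S K n p := by
  have aux : ∀ {t : ℝ}, t ∈ Icc (0 : ℝ) 1 → l * t + (1 - l) / 2 ∈ Icc (0 : ℝ) 1 := by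
    intro t ht
    have h1 := mul_nonneg hl.1 ht.1
    have h2 := mul_nonneg hl.1 (sub_nonneg.mpr ht.2)
    have h3 := hl.2
    constructor <;> nlinarith [hl.1]
  refine h.box_step (C := C) (U := U) (V := V) (W := c + c - (C + C + U + V)) h0 hU hV hUV ?_ ?_ ?_ ?_
    (aux hα) (aux hβ) (γ := (1 - l) / 2) ⟨by linarith [hl.2], by linarith [hl.1]⟩ hn ?_
  · convert h.sym _ hUV using 1; abel
  · convert h.sym _ hV using 1; abel
  · convert h.sym _ hU using 1; abel
  · convert h.sym _ h0 using 1; abel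
  · rw [hp]
    congr 1
    simp only [c3_add, c3_sub]
    module

theorem Core.ineq {S K c} (h : Core S K c) (a b d e : ℝ)
    (hS : ∀ z ∈ S, a * z.1 + b * z.2.1 + d * z.2.2 ≤ e) :
    ∀ x ∈ K, a * x.1 + b * x.2.1 + d * x.2.2 ≤ e := by
  intro x hx
  rw [h.hull] at hx
  have hc : Convex ℝ {x : ℝ × ℝ × ℝ | a * x.1 + b * x.2.1 + d * x.2.2 ≤ e} := by
    apply convex_halfSpace_le
    constructor
    · intro x y; simp; ring
    · intro t x; simp; ring
  refine convexHull_min ?_ hc hx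
  rintro _ ⟨z, hz, rfl⟩
  exact hS z hz

theorem Core.center_mem {S K c} (h : Core S K c) : c3 c ∈ K := by
  have h1 := h.mem (h.sym _ h.h000)
  refine c3_comb4 h.convex (h.mem h.h000) h1 h1 h1 (i := 1) (j := 1) (k := 0) (l := 0) (by norm_num) (by norm_num)
    le_rfl le_rfl (by norm_num) ?_ ?_ ?_
  · simp [c3]; ring
  · simp [c3]; ring
  · simp [c3]; ring

/-- The data of the exceptional case, where the facet is a unimodular triangle. -/
structure Tri (S : Set (ℤ × ℤ × ℤ)) (k : ℤ) : Prop where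
  k2 : 2 ≤ k
  hk0 : (k, 0, 1) ∈ S
  h0k : (0, k, 1) ∈ S
  ineq : ∀ z ∈ S, z.1 + z.2.1 ≤ 1 + (k - 1) * z.2.2

theorem Core.tri {S K c} (h : Core S K c)
    (h3 : ∀ i j : ℤ, (i, j, 0) ∈ S → (i = 0 ∧ j = 0) ∨ (i = 1 ∧ j = 0) ∨ (i = 0 ∧ j = 1)) : ∃ k, Tri S k := by
  obtain ⟨f, g, u, hf, hg, hu, hall⟩ := h.face_vertex (1, 0) h.h100 1 0 (by
    rintro ⟨i, j⟩ hz hne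
    rcases h3 i j hz with ⟨rfl, rfl⟩ | ⟨rfl, rfl⟩ | ⟨rfl, rfl⟩
    · norm_num
    · exact absurd rfl hne
    · norm_num)
  obtain ⟨f', g', u', hf', hg', hu', hall'⟩ := h.face_vertex (0, 1) h.h010 0 1 (by
    rintro ⟨i, j⟩ hz hne
    rcases h3 i j hz with ⟨rfl, rfl⟩ | ⟨rfl, rfl⟩ | ⟨rfl, rfl⟩
    · norm_num
    · norm_num
    · exact absurd rfl hne)
  have I1 : ∀ z ∈ S, z.1 + z.2.1 ≤ 1 + z.2.2 * (u.1 + u.2) ∧ z.2.2 * u.2 ≤ z.2.1 := by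
    intro z hz
    obtain ⟨i, j, hi, hj, e1, e2⟩ := hall z hz
    obtain ⟨i0, j0, hi0, hj0, e10, e20⟩ := hall _ h.h000
    obtain ⟨i1, j1, hi1, hj1, e11, e21⟩ := hall _ h.h010
    simp only at e1 e2 e10 e20 e11 e21
    simp only [mul_add]
    generalize z.2.2 * u.1 = A at *
    generalize z.2.2 * u.2 = B at *
    have hh : ∀ x y : ℤ, (1 + x, 0 + y, 0) ∈ S → (x = -1 ∧ y = 0) ∨ (x = 0 ∧ y = 0) ∨ (x = -1 ∧ y = 1) := by
      intro x y hxy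
      have := h3 _ _ hxy
      omega
    obtain ⟨f1, f2⟩ := f
    obtain ⟨g1, g2⟩ := g
    have kf := hh f1 f2 hf
    have kg := hh g1 g2 hg
    clear hh hf hg hall
    simp only at e1 e2 e10 e20 e11 e21
    rcases kf with ⟨rfl, rfl⟩ | ⟨rfl, rfl⟩ | ⟨rfl, rfl⟩ <;> rcases kg with ⟨rfl, rfl⟩ | ⟨rfl, rfl⟩ | ⟨rfl, rfl⟩ <;> omega
  have I2 : ∀ z ∈ S, z.1 + z.2.1 ≤ 1 + z.2.2 * (u'.1 + u'.2) ∧ z.2.2 * u'.1 ≤ z.1 := by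
    intro z hz
    obtain ⟨i, j, hi, hj, e1, e2⟩ := hall' z hz
    obtain ⟨i0, j0, hi0, hj0, e10, e20⟩ := hall' _ h.h000
    obtain ⟨i1, j1, hi1, hj1, e11, e21⟩ := hall' _ h.h100
    simp only at e1 e2 e10 e20 e11 e21
    simp only [mul_add]
    generalize z.2.2 * u'.1 = A at *
    generalize z.2.2 * u'.2 = B at *
    have hh : ∀ x y : ℤ, (0 + x, 1 + y, 0) ∈ S → (x = 0 ∧ y = -1) ∨ (x = 0 ∧ y = 0) ∨ (x = 1 ∧ y = -1) := by
      intro x y hxy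
      have := h3 _ _ hxy
      omega
    obtain ⟨f1, f2⟩ := f'
    obtain ⟨g1, g2⟩ := g'
    have kf := hh f1 f2 hf'
    have kg := hh g1 g2 hg'
    clear hh hf' hg' hall'
    simp only at e1 e2 e10 e20 e11 e21
    rcases kf with ⟨rfl, rfl⟩ | ⟨rfl, rfl⟩ | ⟨rfl, rfl⟩ <;> rcases kg with ⟨rfl, rfl⟩ | ⟨rfl, rfl⟩ | ⟨rfl, rfl⟩ <;> omega
  have n1 := h.nn _ hu
  have n2 := h.nn _ hu'
  have u20 : u.2 = 0 := by
    have := (I1 _ h.h001).2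
    simp only at this n1
    omega
  have u10 : u'.1 = 0 := by
    have := (I2 _ h.h001).2
    simp only at this n2
    omega
  have a1 := (I1 _ hu').1
  have a2 := (I2 _ hu).1
  simp only at a1 a2
  have hk : u'.2 = u.1 := by omega
  have c1 := (h.nn _ (h.sym _ h.h100)).1
  have c2 := (h.nn _ (h.sym _ h.h010)).2.1
  have c3 := (h.nn _ (h.sym _ h.h001)).2.2
  have c0 := (I1 _ (h.sym _ h.h000)).1
  simp at c1 c2 c3 c0
  rw [u20] at c0
  refine ⟨1 + u.1, ?_, ?_, ?_, ?_⟩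
  · have : 0 < (c.2.2 + c.2.2) * u.1 := by linarith
    have := pos_of_mul_pos_right this (by omega)
    omega
  · convert hu using 1
    simp [u20]
  · convert hu' using 1
    simp [u10, hk]
  · intro z hz
    have := (I1 z hz).1
    rw [u20] at this
    linarith

theorem Core.slab {S K c k} (h : Core S K c) (hT : Tri S k) (x : ℝ × ℝ × ℝ) (h1 : 0 ≤ x.1) (h2 : 0 ≤ x.2.1)
    (h3 : 0 ≤ x.2.2) (h3' : x.2.2 ≤ 1) (hs : x.1 + x.2.1 ≤ 1 + (k - 1) * x.2.2) : x ∈ K := by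
  have hk : (2 : ℝ) ≤ k := by exact_mod_cast hT.k2
  obtain ⟨s, hsd⟩ : ∃ s : ℝ, s = 1 + (k - 1) * x.2.2 := ⟨_, rfl⟩
  have hs0 : 0 < s := by
    have : 0 ≤ ((k : ℝ) - 1) * x.2.2 := mul_nonneg (by linarith) h3
    linarith
  rw [← hsd] at hs
  have ha : 0 ≤ x.1 / s := div_nonneg h1 hs0.le
  have hb : 0 ≤ x.2.1 / s := div_nonneg h2 hs0.le
  have hab : x.1 / s + x.2.1 / s ≤ 1 := by rw [← add_div, div_le_one hs0]; exact hs
  have ea : x.1 / s * s = x.1 := div_mul_cancel₀ _ hs0.ne'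
  have eb : x.2.1 / s * s = x.2.1 := div_mul_cancel₀ _ hs0.ne'
  generalize x.1 / s = a at *
  generalize x.2.1 / s = b at *
  have b0 : ((a, b, 0) : ℝ × ℝ × ℝ) ∈ K := by
    refine c3_comb4 h.convex (h.mem h.h000) (h.mem h.h100) (h.mem h.h010) (h.mem h.h000) (i := 1 - a - b) (j := a) (k := b) (l := 0)
      (by linarith) ha hb le_rfl (by linarith) ?_ ?_ ?_ <;> simp [c3] <;> ring
  have b1 : ((a * k, b * k, 1) : ℝ × ℝ × ℝ) ∈ K := by
    refine c3_comb4 h.convex (h.mem h.h001) (h.mem hT.hk0) (h.mem hT.h0k) (h.mem h.h000) (i := 1 - a - b) (j := a) (k := b) (l := 0)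
      (by linarith) ha hb le_rfl (by linarith) ?_ ?_ ?_ <;> simp [c3] <;> ring
  refine c3_comb4 h.convex b0 b1 b0 b0 (i := 1 - x.2.2) (j := x.2.2) (k := 0) (l := 0) (by linarith) h3 le_rfl le_rfl
    (by linarith) ?_ ?_ ?_
  · simp; rw [← ea, hsd]; ring
  · simp; rw [← eb, hsd]; ring
  · simp

theorem Core.top_mem {S K c k} (h : Core S K c) (hT : Tri S k) (i j : ℤ) (hi : 0 ≤ i) (hj : 0 ≤ j) (hij : i + j ≤ k) :
    (i, j, 1) ∈ S := by
  apply h.sat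
  have hij' : (i : ℝ) + j ≤ k := by exact_mod_cast hij
  refine h.slab hT _ ?_ ?_ ?_ ?_ ?_ <;> simp [c3]
  · exact hi
  · exact hj
  · exact hij'

theorem Core.bot_mem {S K c} (h : Core S K c) (i j : ℤ) (hi : 0 ≤ i) (hj : 0 ≤ j) (hij : i + j ≤ 1) :
    (i, j, 0) ∈ S := by
  have : (i = 0 ∧ j = 0) ∨ (i = 1 ∧ j = 0) ∨ (i = 0 ∧ j = 1) := by omega
  rcases this with ⟨rfl, rfl⟩ | ⟨rfl, rfl⟩ | ⟨rfl, rfl⟩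
  · exact h.h000
  · exact h.h100
  · exact h.h010

theorem Core.ineqK {S K c k} (h : Core S K c) (hT : Tri S k) (x : ℝ × ℝ × ℝ) (hx : x ∈ K) :
    0 ≤ x.1 ∧ 0 ≤ x.2.1 ∧ 0 ≤ x.2.2 ∧ x.1 + x.2.1 ≤ 1 + (k - 1) * x.2.2 := by
  refine ⟨?_, ?_, ?_, ?_⟩
  · have := h.ineq (-1) 0 0 0 (fun z hz => by have := (h.nn z hz).1; simp; exact this) x hx
    linarith
  · have := h.ineq 0 (-1) 0 0 (fun z hz => by have := (h.nn z hz).2.1; simp; exact this) x hx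
    linarith
  · have := h.ineq 0 0 (-1) 0 (fun z hz => by have := (h.nn z hz).2.2; simp; exact this) x hx
    linarith
  · have := h.ineq 1 1 (-(k - 1)) 1 (fun z hz => by
      have := hT.ineq z hz
      have : (z.1 : ℝ) + z.2.1 ≤ 1 + (k - 1) * z.2.2 := by exact_mod_cast this
      linarith) x hx
    linarith

theorem Core.low_step {S K c k} (h : Core S K c) (hT : Tri S k) (x : ℝ × ℝ × ℝ) (hx : x ∈ K) (h1 : x.2.2 ≤ 1)
    (n : ℕ) (hn : 2 ≤ n) (p : ℤ × ℤ × ℤ) (hp : c3 p = (n : ℝ) • x) : StepAt S K n p := by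
  obtain ⟨x1, x2, x3, x4⟩ := h.ineqK hT x hx
  obtain ⟨p1, p2, p3⟩ := p
  have e1 : (p1 : ℝ) = n * x.1 := congrArg (fun v => v.1) hp
  have e2 : (p2 : ℝ) = n * x.2.1 := congrArg (fun v => v.2.1) hp
  have e3 : (p3 : ℝ) = n * x.2.2 := congrArg (fun v => v.2.2) hp
  have hn0 : (0 : ℝ) ≤ n := Nat.cast_nonneg n
  have g1 : 0 ≤ p1 := by have : (0 : ℝ) ≤ p1 := by rw [e1]; positivity
                         exact_mod_cast this
  have g2 : 0 ≤ p2 := by have : (0 : ℝ) ≤ p2 := by rw [e2]; positivity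
                         exact_mod_cast this
  have g3 : 0 ≤ p3 := by have : (0 : ℝ) ≤ p3 := by rw [e3]; positivity
                         exact_mod_cast this
  have g3' : p3 ≤ n := by
    have : (p3 : ℝ) ≤ n := by rw [e3]; nlinarith
    exact_mod_cast this
  have g4 : p1 + p2 ≤ n + (k - 1) * p3 := by
    have : (p1 : ℝ) + p2 ≤ n + (k - 1) * p3 := by rw [e1, e2, e3]; nlinarith
    exact_mod_cast this
  have hk := hT.k2
  have hq : ∃ q1 q2 q3 : ℤ, (q1, q2, q3) ∈ S ∧ 0 ≤ p1 - q1 ∧ 0 ≤ p2 - q2 ∧ 0 ≤ p3 - q3 ∧ p3 - q3 ≤ n - 1 ∧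
      (p1 - q1) + (p2 - q2) ≤ (n - 1) + (k - 1) * (p3 - q3) := by
    by_cases h0 : p3 = 0
    · subst h0
      obtain ⟨q1, q2, r1, r2, r3, r4, r5, r6⟩ : ∃ q1 q2 : ℤ, 0 ≤ q1 ∧ 0 ≤ q2 ∧ q1 ≤ p1 ∧ q2 ≤ p2 ∧ q1 + q2 ≤ 1 ∧
        (q1 + q2 = 1 ∨ q1 + q2 = p1 + p2) := by
        refine ⟨min p1 1, min p2 (1 - min p1 1), ?_⟩
        omega
      refine ⟨q1, q2, 0, h.bot_mem q1 q2 r1 r2 r5, by omega, by omega, by omega, by omega, ?_⟩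
      simp at g4 ⊢
      omega
    · obtain ⟨q1, q2, r1, r2, r3, r4, r5, r6⟩ : ∃ q1 q2 : ℤ, 0 ≤ q1 ∧ 0 ≤ q2 ∧ q1 ≤ p1 ∧ q2 ≤ p2 ∧ q1 + q2 ≤ k ∧
        (q1 + q2 = k ∨ q1 + q2 = p1 + p2) := by
        refine ⟨min p1 k, min p2 (k - min p1 k), ?_⟩
        omega
      refine ⟨q1, q2, 1, h.top_mem hT q1 q2 r1 r2 r5, by omega, by omega, by omega, by omega, ?_⟩
      rcases r6 with r6 | r6
      · linarith
      · have : 0 ≤ (k - 1) * (p3 - 1) := mul_nonneg (by omega) (by omega)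
        linarith
  obtain ⟨q1, q2, q3, hqS, r1, r2, r3, r4, r5⟩ := hq
  have r1' : (0 : ℝ) ≤ p1 - q1 := by exact_mod_cast r1
  have r2' : (0 : ℝ) ≤ p2 - q2 := by exact_mod_cast r2
  have r3' : (0 : ℝ) ≤ p3 - q3 := by exact_mod_cast r3
  have r4' : (p3 : ℝ) - q3 ≤ n - 1 := by exact_mod_cast r4
  have r5' : ((p1 : ℝ) - q1) + (p2 - q2) ≤ (n - 1) + (k - 1) * (p3 - q3) := by exact_mod_cast r5
  have hn' : (2 : ℝ) ≤ n := by exact_mod_cast hn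
  have hm : (0 : ℝ) < n - 1 := by linarith
  refine ⟨_, hqS, ((p1 - q1) / (n - 1), (p2 - q2) / (n - 1), (p3 - q3) / (n - 1)), ?_, ?_⟩
  · refine h.slab hT _ (div_nonneg r1' hm.le) (div_nonneg r2' hm.le) (div_nonneg r3' hm.le) ?_ ?_
    · rw [div_le_one hm]; exact r4'
    · simp only
      rw [← add_div, ← mul_div_assoc, div_le_iff₀ hm, add_mul, div_mul_cancel₀ _ hm.ne']
      linarith
  · ext
    · simp [c3]; field_simp
    · simp [c3]; field_simp
    · simp [c3]; field_simp

theorem Core.high_step {S K c k} (h : Core S K c) (hT : Tri S k) (y : ℝ × ℝ × ℝ) (hy : y ∈ K) (hy1 : y.2.2 = 1)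
    (l : ℝ) (hl : l ∈ Icc (0 : ℝ) 1) (n : ℝ) (hn : 2 ≤ n) (p : ℤ × ℤ × ℤ) (hp : c3 p = n • (l • y + (1 - l) • c3 c)) :
    StepAt S K n p := by
  obtain ⟨y1, y2, y3, y4⟩ := h.ineqK hT y hy
  rw [hy1] at y4
  have hk := hT.k2
  have f1 := Int.floor_le y.1
  have f2 := Int.floor_le y.2.1
  have f3 := Int.lt_floor_add_one y.1
  have f4 := Int.lt_floor_add_one y.2.1
  have f5 := Int.floor_nonneg.mpr y1
  have f6 := Int.floor_nonneg.mpr y2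
  generalize ⌊y.1⌋ = a at *
  generalize ⌊y.2.1⌋ = b at *
  have hab : a + b ≤ k := by
    have : (a : ℝ) + b ≤ k := by linarith
    exact_mod_cast this
  have fin : ∀ (U V : ℤ × ℤ) (α β : ℝ), α ∈ Icc (0 : ℝ) 1 → β ∈ Icc (0 : ℝ) 1 →
      (0 ≤ a + U.1 ∧ 0 ≤ b + U.2 ∧ a + U.1 + (b + U.2) ≤ k) → (0 ≤ a + V.1 ∧ 0 ≤ b + V.2 ∧ a + V.1 + (b + V.2) ≤ k) →
      (0 ≤ a + U.1 + V.1 ∧ 0 ≤ b + U.2 + V.2 ∧ a + U.1 + V.1 + (b + U.2 + V.2) ≤ k) →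
      y.1 = a + α * U.1 + β * V.1 → y.2.1 = b + α * U.2 + β * V.2 → StepAt S K n p := by
    intro U V α β hα hβ hU hV hUV e1 e2
    refine h.para_step (C := (a, b, 1)) (U := (U.1, U.2, 0)) (V := (V.1, V.2, 0)) (h.top_mem hT _ _ f5 f6 hab)
      ?_ ?_ ?_ hα hβ hl hn ?_
    · exact h.top_mem hT _ _ hU.1 hU.2.1 hU.2.2
    · exact h.top_mem hT _ _ hV.1 hV.2.1 hV.2.2
    · exact h.top_mem hT _ _ hUV.1 hUV.2.1 hUV.2.2
    · rw [hp]
      congr 3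
      ext
      · simp [c3, e1]
      · simp [c3, e2]
      · simp [c3, hy1]
  by_cases c1 : a + b + 2 ≤ k
  · refine fin (1, 0) (0, 1) (y.1 - a) (y.2.1 - b) ⟨by linarith, by linarith⟩ ⟨by linarith, by linarith⟩ ?_ ?_ ?_ ?_ ?_
    · simp only; omega
    · simp only; omega
    · simp only; omega
    · simp
    · simp
  by_cases c2 : a + b = k
  · have c2' : (a : ℝ) + b = k := by exact_mod_cast c2
    refine fin (0, 0) (0, 0) 0 0 ⟨by norm_num, by norm_num⟩ ⟨by norm_num, by norm_num⟩ ?_ ?_ ?_ ?_ ?_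
    · simp only; omega
    · simp only; omega
    · simp only; omega
    · simp; linarith
    · simp; linarith
  have c3 : a + b + 1 = k := by omega
  have c3' : (a : ℝ) + b + 1 = k := by exact_mod_cast c3
  by_cases ha : 1 ≤ a
  · refine fin (1, 0) (-1, 1) (y.1 - a + (y.2.1 - b)) (y.2.1 - b) ⟨by linarith, by linarith⟩ ⟨by linarith, by linarith⟩ ?_ ?_ ?_ ?_ ?_
    · simp only; omega
    · simp only; omega
    · simp only; omega
    · simp; ring
    · simp
  · refine fin (1, -1) (0, 1) (y.1 - a) (y.1 - a + (y.2.1 - b)) ⟨by linarith, by linarith⟩ ⟨by linarith, by linarith⟩ ?_ ?_ ?_ ?_ ?_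
    · simp only; omega
    · simp only; omega
    · simp only; omega
    · simp
    · simp; ring

theorem Core.step {S K c} (h : Core S K c) (y : ℝ × ℝ × ℝ) (hy : y ∈ K) (hy0 : y.2.2 = 0)
    (l : ℝ) (hl : l ∈ Icc (0 : ℝ) 1) (n : ℕ) (hn : 2 ≤ n) (p : ℤ × ℤ × ℤ)
    (hp : c3 p = (n : ℝ) • (l • y + (1 - l) • c3 c)) : StepAt S K n p := by
  have hn' : (2 : ℝ) ≤ n := by exact_mod_cast hn
  by_cases h3 : ∀ i j : ℤ, (i, j, 0) ∈ S → (i = 0 ∧ j = 0) ∨ (i = 1 ∧ j = 0) ∨ (i = 0 ∧ j = 1)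
  · obtain ⟨k, hT⟩ := h.tri h3
    by_cases hx : (l • y + (1 - l) • c3 c).2.2 ≤ 1
    · exact h.low_step hT _ (h.convex hy h.center_mem hl.1 (by linarith [hl.2]) (by ring)) hx n hn p hp
    · have hx' : 1 < (1 - l) * (c.2.2 : ℝ) := by simpa [c3, hy0] using hx
      have hc : 0 < (c.2.2 : ℝ) := by
        have := (h.ineqK hT _ h.center_mem).2.2.1
        simp only [c3] at this
        rcases this.eq_or_lt with h | h
        · rw [← h] at hx'; norm_num at hx'
        · exact h
      obtain ⟨m, hm⟩ : ∃ m : ℝ, m * c.2.2 = c.2.2 - 1 := ⟨(c.2.2 - 1) / c.2.2, by field_simp⟩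
      have hlm : l < m := by
        by_contra hcon
        have := mul_le_mul_of_nonneg_right (not_lt.mp hcon) hc.le
        linarith
      have hm0 : 0 < m := by linarith [hl.1]
      have hm1 : m ≤ 1 := by
        by_contra hcon
        have := mul_lt_mul_of_pos_right (not_le.mp hcon) hc
        linarith
      refine h.high_step hT (m • y + (1 - m) • c3 c) (h.convex hy h.center_mem hm0.le (by linarith) (by ring)) ?_ (l / m)
        ⟨div_nonneg hl.1 hm0.le, (div_le_one hm0).mpr hlm.le⟩ n hn' p ?_
      · simp [c3, hy0]; linarith
      · rw [hp]
        congr 1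
        rw [smul_add, smul_smul, smul_smul, div_mul_cancel₀ _ hm0.ne', add_assoc, ← add_smul]
        congr 2
        field_simp
        ring
  · push Not at h3
    obtain ⟨i, j, hij, n1, n2, n3⟩ := h3
    obtain ⟨C, U, W, hC, hU, hW, hUW, α, β, a0, a1, b0, b1, e1, e2⟩ := h.sm2.cover (by
      intro a b c
      by_contra hcon
      push Not at hcon
      have hsub : ({(0, 0), (1, 0), (0, 1), (i, j)} : Finset (ℤ × ℤ)) ⊆ {a, b, c} := by
        intro z hz
        have hzS : (z.1, z.2, 0) ∈ S := by
          simp only [Finset.mem_insert, Finset.mem_singleton] at hz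
          rcases hz with rfl | rfl | rfl | rfl
          · exact h.h000
          · exact h.h100
          · exact h.h010
          · exact hij
        have := hcon z hzS
        simp only [Finset.mem_insert, Finset.mem_singleton]
        tauto
      have := (Finset.card_le_card hsub).trans Finset.card_le_three
      rw [Finset.card_insert_of_notMem, Finset.card_insert_of_notMem, Finset.card_insert_of_notMem, Finset.card_singleton] at this
      · omega
      · simp; intro h1; exact fun h2 => n3 h1.symm h2.symm
      · simp; intro h1; exact fun h2 => n2 h1.symm h2.symm
      · simp; intro h1; exact fun h2 => n1 h1.symm h2.symm) _ (h.face_hull y hy hy0)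
    refine h.para_step (C := (C.1, C.2, 0)) (U := (U.1, U.2, 0)) (V := (W.1, W.2, 0)) hC hU hW hUW ⟨a0, a1⟩ ⟨b0, b1⟩ hl hn' ?_
    rw [hp]
    congr 3
    simp only at e1 e2
    ext
    · simp [c3, e1]
    · simp [c3, e2]
    · simp [c3, hy0]

open Matrix in
/-- Adapted lattice basis (rows of `E`) at a vertex `v` of `P`. -/
structure VData (P : Set (Fin 3 → ℝ)) (v : Fin 3 → ℤ) (E M : Matrix (Fin 3) (Fin 3) ℤ) : Prop where
  mem : toR v ∈ P
  inv : M * E = 1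
  cone : ∀ x ∈ P, ∀ i, 0 ≤ ((x - toR v) ᵥ* M.map (Int.cast : ℤ → ℝ)) i
  gen : ∀ i, toR (v + E.row i) ∈ P

theorem toR_add {d : ℕ} (a b : Fin d → ℤ) : toR (a + b) = toR a + toR b := by ext; simp [toR]
theorem toR_sub {d : ℕ} (a b : Fin d → ℤ) : toR (a - b) = toR a - toR b := by ext; simp [toR]
theorem toR_neg {d : ℕ} (a : Fin d → ℤ) : toR (-a) = - toR a := by ext; simp [toR]
theorem toR_inj {d : ℕ} {a b : Fin d → ℤ} (h : toR a = toR b) : a = b := by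
  ext i; have := congrFun h i; simpa [toR] using this
theorem toR_vecMul (a : Fin 3 → ℤ) (M : Matrix (Fin 3) (Fin 3) ℤ) :
    toR (Matrix.vecMul a M) = Matrix.vecMul (toR a) (M.map (Int.cast : ℤ → ℝ)) := by
  ext i; simp [toR, Matrix.vecMul, dotProduct]

theorem cast_inv {M E : Matrix (Fin 3) (Fin 3) ℤ} (h : M * E = 1) :
    M.map (Int.cast : ℤ → ℝ) * E.map (Int.cast : ℤ → ℝ) = 1 := by
  have := congrArg (fun A : Matrix (Fin 3) (Fin 3) ℤ => (Int.castRingHom ℝ).mapMatrix A) h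
  simp only [map_mul, map_one] at this
  exact this

theorem VData.perm {P v E M} (h : VData P v E M) (σ : Equiv.Perm (Fin 3)) :
    VData P v (E.submatrix σ id) (M.submatrix id σ) := by
  refine ⟨h.mem, ?_, ?_, ?_⟩
  · rw [Matrix.submatrix_mul_equiv, h.inv]; simp
  · intro x hx i
    exact h.cone x hx (σ i)
  · intro i; exact h.gen (σ i)

theorem VData.coord {P v E M} (h : VData P v E M) (t : Fin 3 → ℝ) :
    Matrix.vecMul (Matrix.vecMul t (E.map (Int.cast : ℤ → ℝ))) (M.map (Int.cast : ℤ → ℝ)) = t := by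
  rw [Matrix.vecMul_vecMul, cast_inv (mul_eq_one_comm.mp h.inv), Matrix.vecMul_one]

theorem VData.coord' {P v E M} (h : VData P v E M) (t : Fin 3 → ℝ) :
    Matrix.vecMul (Matrix.vecMul t (M.map (Int.cast : ℤ → ℝ))) (E.map (Int.cast : ℤ → ℝ)) = t := by
  rw [Matrix.vecMul_vecMul, cast_inv h.inv, Matrix.vecMul_one]

theorem exists_vdata {P : Set (Fin 3 → ℝ)} (hP : IsSmoothPolytope P) (hdim : affineSpan ℝ P = ⊤)
    {v : Fin 3 → ℝ} (hv : v ∈ extremePoints ℝ P) : ∃ (z : Fin 3 → ℤ) (E M : Matrix (Fin 3) (Fin 3) ℤ), v = toR z ∧ VData P z E M := by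
  obtain ⟨⟨V, hV⟩, hs⟩ := hP
  have hvV : v ∈ toR '' (V : Set (Fin 3 → ℤ)) := by
    rw [hV] at hv; exact extremePoints_convexHull_subset hv
  obtain ⟨z, hz, rfl⟩ := hvV
  obtain ⟨k, e, hli, hcone, hspan⟩ := hs _ hv
  have hvs : vectorSpan ℝ P = ⊤ := by
    rw [← direction_affineSpan, hdim, AffineSubspace.direction_top]
  have htop : ∀ z : Fin 3 → ℤ, z ∈ Submodule.span ℤ (Set.range e) := fun z => hspan z (by rw [hvs]; trivial)
  have hk : k = 3 := by
    have b := Module.Basis.mk hli (fun z _ => htop z)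
    have h1 := Module.finrank_eq_card_basis b
    simp at h1
    exact h1.symm
  subst hk
  have hM : ∀ j : Fin 3, ∃ m : Fin 3 → ℤ, ∑ i, m i • e i = Pi.single j 1 := by
    intro j
    exact (Submodule.mem_span_range_iff_exists_fun ℤ).mp (htop (Pi.single j 1))
  choose M hM using hM
  have hinv : (Matrix.of M) * (Matrix.of e) = 1 := by
    ext i j
    have := congrFun (hM i) j
    rw [Matrix.mul_apply, Matrix.one_apply]
    simp only [Finset.sum_apply, Pi.smul_apply, smul_eq_mul] at this
    simp only [Matrix.of_apply]
    rw [this, Pi.single_apply]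
    simp [eq_comm]
  have hinv' := cast_inv (mul_eq_one_comm.mp hinv)
  have hsum : ∀ t : Fin 3 → ℝ, ∑ i, t i • toR (e i) = Matrix.vecMul t ((Matrix.of e).map (Int.cast : ℤ → ℝ)) := by
    intro t
    ext j
    simp [Matrix.vecMul, dotProduct, toR]
  have hcn : ∀ x ∈ P, ∀ i, 0 ≤ (Matrix.vecMul (x - toR z) ((Matrix.of M).map (Int.cast : ℤ → ℝ))) i := by
    intro x hx i
    have : x - toR z ∈ coneAt P (toR z) := ⟨1, zero_le_one, x, hx, by simp⟩
    rw [hcone] at this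
    obtain ⟨t, ht, hxt⟩ := this
    rw [hxt, hsum, Matrix.vecMul_vecMul, hinv', Matrix.vecMul_one]
    exact ht i
  have hVP : ∀ u ∈ V, toR u ∈ P := fun u hu => by rw [hV]; exact subset_convexHull ℝ _ ⟨u, hu, rfl⟩
  refine ⟨z, Matrix.of e, Matrix.of M, rfl, hv.1, hinv, hcn, ?_⟩
  intro i
  have : toR (e i) ∈ coneAt P (toR z) := by
    rw [hcone]
    refine ⟨Pi.single i 1, ?_, ?_⟩
    · intro j; by_cases h : j = i
      · subst h; simp
      · simp [h]
    · rw [Finset.sum_eq_single i] <;> simp +contextual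
  obtain ⟨s, hs0, x, hx, hxe⟩ := this
  have hecoord : Matrix.vecMul (toR (e i)) ((Matrix.of M).map (Int.cast : ℤ → ℝ)) = Pi.single i 1 := by
    have h1 := hsum (Pi.single i 1)
    rw [Finset.sum_eq_single i (by simp +contextual) (by simp)] at h1
    simp only [Pi.single_eq_same, one_smul] at h1
    rw [h1, Matrix.vecMul_vecMul, hinv', Matrix.vecMul_one]
  have hsx : s • Matrix.vecMul (x - toR z) ((Matrix.of M).map (Int.cast : ℤ → ℝ)) = Pi.single i 1 := by
    rw [← hecoord, hxe, Matrix.smul_vecMul]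
  have hs1 : 0 < s := by
    rcases hs0.eq_or_lt with h | h
    · rw [← h, zero_smul] at hsx
      have := congrFun hsx i
      simp at this
    · exact h
  -- write `x` as a convex combination
  rw [hV] at hx
  obtain ⟨ι, hι, u, w, hu, -, hw, hw1, hwx⟩ := eq_pos_convex_span_of_mem_convexHull hx
  have hu' : ∀ a, ∃ p ∈ V, toR p = u a := fun a => by
    have := hu ⟨a, rfl⟩
    exact this
  choose p hp hpu using hu'
  have hdec : Matrix.vecMul (x - toR z) ((Matrix.of M).map (Int.cast : ℤ → ℝ)) =
      ∑ a, w a • toR (Matrix.vecMul (p a - z) (Matrix.of M)) := by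
    have : x - toR z = ∑ a, w a • toR (p a - z) := by
      simp only [toR_sub, smul_sub, Finset.sum_sub_distrib, ← Finset.sum_smul, hw1, one_smul, hpu, hwx]
    rw [this, Matrix.sum_vecMul]
    refine Finset.sum_congr rfl fun a _ => ?_
    rw [Matrix.smul_vecMul, toR_vecMul]
  have hnn : ∀ a j, 0 ≤ Matrix.vecMul (p a - z) (Matrix.of M) j := by
    intro a j
    have := hcn _ (hVP _ (hp a)) j
    rw [← toR_sub, ← toR_vecMul] at this
    simpa [toR] using this
  have hnn' : ∀ a j, (0 : ℝ) ≤ w a * ((Matrix.vecMul (p a - z) (Matrix.of M) j : ℤ) : ℝ) := by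
    intro a j
    exact mul_nonneg (hw a).le (by exact_mod_cast hnn a j)
  have hzero : ∀ a j, j ≠ i → Matrix.vecMul (p a - z) (Matrix.of M) j = 0 := by
    intro a j hj
    have h1 := congrFun hsx j
    rw [hdec] at h1
    simp only [Pi.smul_apply, Finset.sum_apply, smul_eq_mul, toR, Pi.single_apply, hj, if_false] at h1
    have h2 := (mul_eq_zero.mp h1).resolve_left hs1.ne'
    rw [Finset.sum_eq_zero_iff_of_nonneg (fun a _ => hnn' a j)] at h2
    have h3 := (mul_eq_zero.mp (h2 a (Finset.mem_univ _))).resolve_left (hw a).ne'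
    exact_mod_cast h3
  obtain ⟨a, ha⟩ : ∃ a, Matrix.vecMul (p a - z) (Matrix.of M) i ≠ 0 := by
    by_contra hcon
    push Not at hcon
    have h1 := congrFun hsx i
    rw [hdec] at h1
    simp only [Pi.smul_apply, Finset.sum_apply, smul_eq_mul, toR, Pi.single_eq_same, hcon] at h1
    simp at h1
  have ha1 : 1 ≤ Matrix.vecMul (p a - z) (Matrix.of M) i := by have := hnn a i; omega
  obtain ⟨m, hm⟩ : ∃ m, Matrix.vecMul (p a - z) (Matrix.of M) i = m := ⟨_, rfl⟩
  rw [hm] at ha1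
  have hpa : p a - z = m • e i := by
    have : Matrix.vecMul (p a - z) (Matrix.of M) = m • Pi.single i 1 := by
      ext j
      by_cases hj : j = i
      · subst hj; simp [hm]
      · simp [hj, hzero a j hj]
    have h2 := congrArg (fun t => Matrix.vecMul t (Matrix.of e)) this
    simp only [Matrix.vecMul_vecMul, hinv, Matrix.vecMul_one, Matrix.smul_vecMul] at h2
    rw [h2, Matrix.single_one_vecMul]
    rfl
  have hm1 : (1 : ℝ) ≤ m := by exact_mod_cast ha1
  have hc : Convex ℝ P := by rw [hV]; exact convex_convexHull ℝ _
  have h3 := hc.add_smul_mem (x := toR z) (y := toR (p a - z)) hv.1 (by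
    rw [← toR_add]; simpa using hVP _ (hp a)) (t := 1 / (m : ℝ)) ⟨by positivity, by
      rw [div_le_one (by linarith)]; exact hm1⟩
  convert h3 using 1
  rw [toR_add, hpa]
  congr 1
  ext j
  have : (m : ℝ) ≠ 0 := by linarith
  simp [toR]
  field_simp

theorem extreme_of_lin {X : Type*} [AddCommGroup X] [Module ℝ X] {A P : Set X} (hP : P = convexHull ℝ A)
    (v : X) (hv : v ∈ P) (f : X →ₗ[ℝ] ℝ) (hf : ∀ a ∈ A, a ≠ v → f a < f v) : v ∈ extremePoints ℝ P := by
  have key : ∀ x ∈ P, x ≠ v → f x < f v := by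
    have hc : Convex ℝ {x | x ≠ v → f x < f v} := by
      intro x hx y hy a b ha hb hab hne
      simp only [Set.mem_ofPred_eq] at hx hy
      have hx' : f x ≤ f v := by
        by_cases h : x = v
        · rw [h]
        · exact (hx h).le
      have hy' : f y ≤ f v := by
        by_cases h : y = v
        · rw [h]
        · exact (hy h).le
      rcases ha.eq_or_lt with h | h
      · subst h
        have hb1 : b = 1 := by linarith
        subst hb1
        simp only [zero_smul, one_smul, zero_add] at hne ⊢
        exact hy hne
      rcases hb.eq_or_lt with h' | h'
      · subst h'
        have hb1 : a = 1 := by linarith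
        subst hb1
        simp only [zero_smul, one_smul, add_zero] at hne ⊢
        exact hx hne
      rw [map_add, map_smul, map_smul, smul_eq_mul, smul_eq_mul]
      have hfv : f v = a * f v + b * f v := by rw [← add_mul, hab, one_mul]
      by_cases hxv : x = v
      · have hyv : y ≠ v := by
          rintro rfl
          apply hne
          rw [hxv, ← add_smul, hab, one_smul]
        have := mul_lt_mul_of_pos_left (hy hyv) h'
        have := mul_le_mul_of_nonneg_left hx' ha
        linarith
      · have := mul_lt_mul_of_pos_left (hx hxv) h
        have := mul_le_mul_of_nonneg_left hy' hb
        linarith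
    intro x hx
    rw [hP] at hx
    exact convexHull_min (fun a ha => hf a ha) hc hx
  rw [mem_extremePoints]
  refine ⟨hv, ?_⟩
  have le : ∀ x ∈ P, f x ≤ f v := by
    intro x hx
    by_cases h : x = v
    · rw [h]
    · exact (key x hx h).le
  rintro x hx y hy ⟨a, b, ha, hb, hab, hxy⟩
  have hfv : f v = a * f x + b * f y := by rw [← hxy]; simp
  have hfv' : f v = a * f v + b * f v := by rw [← add_mul, hab, one_mul]
  have l1 := mul_le_mul_of_nonneg_left (le x hx) ha.le
  have l2 := mul_le_mul_of_nonneg_left (le y hy) hb.le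
  constructor
  · by_contra hne
    have := mul_lt_mul_of_pos_left (key x hx hne) ha
    linarith
  · by_contra hne
    have := mul_lt_mul_of_pos_left (key y hy hne) hb
    linarith

/-- Vectors from triples and back. -/
def tz (z : ℤ × ℤ × ℤ) : Fin 3 → ℤ := ![z.1, z.2.1, z.2.2]
/-- Vectors from triples and back. -/
def tr (z : ℝ × ℝ × ℝ) : Fin 3 → ℝ := ![z.1, z.2.1, z.2.2]
/-- Vectors from triples and back. -/
def pz (f : Fin 3 → ℤ) : ℤ × ℤ × ℤ := (f 0, f 1, f 2)
/-- Vectors from triples and back. -/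
def pr (f : Fin 3 → ℝ) : ℝ × ℝ × ℝ := (f 0, f 1, f 2)

theorem tz_pz (f) : tz (pz f) = f := by ext i; fin_cases i <;> rfl
theorem tr_pr (f) : tr (pr f) = f := by ext i; fin_cases i <;> rfl
theorem pz_tz (f) : pz (tz f) = f := rfl
theorem pr_tr (f) : pr (tr f) = f := rfl
theorem tr_c3 (z) : tr (c3 z) = toR (tz z) := by ext i; fin_cases i <;> rfl
theorem c3_pz (z) : c3 (pz z) = pr (toR z) := rfl
theorem tz_add (a b) : tz (a + b) = tz a + tz b := by ext i; fin_cases i <;> rfl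
theorem tz_sub (a b) : tz (a - b) = tz a - tz b := by ext i; fin_cases i <;> rfl
theorem tr_add (a b) : tr (a + b) = tr a + tr b := by ext i; fin_cases i <;> rfl
theorem tr_sub (a b) : tr (a - b) = tr a - tr b := by ext i; fin_cases i <;> rfl
theorem tr_smul (s : ℝ) (a) : tr (s • a) = s • tr a := by ext i; fin_cases i <;> rfl
theorem tr_inj {a b} (h : tr a = tr b) : a = b := by rw [← pr_tr a, h, pr_tr]
theorem tz_inj {a b} (h : tz a = tz b) : a = b := by rw [← pz_tz a, h, pz_tz]

/-- The polytope in adapted coordinates. -/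
def KK (P : Set (Fin 3 → ℝ)) (v : Fin 3 → ℤ) (E : Matrix (Fin 3) (Fin 3) ℤ) : Set (ℝ × ℝ × ℝ) :=
  {t | toR v + Matrix.vecMul (tr t) (E.map (Int.cast : ℤ → ℝ)) ∈ P}

/-- The lattice points of the polytope in adapted coordinates. -/
def SS (P : Set (Fin 3 → ℝ)) (v : Fin 3 → ℤ) (E : Matrix (Fin 3) (Fin 3) ℤ) : Set (ℤ × ℤ × ℤ) :=
  {z | c3 z ∈ KK P v E}

theorem mem_SS {P v E z} : z ∈ SS P v E ↔ toR (v + Matrix.vecMul (tz z) E) ∈ P := by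
  rw [toR_add, toR_vecMul, ← tr_c3]; rfl

theorem finite_lattice {P : Set (Fin 3 → ℝ)} (hP : Bornology.IsBounded P) : {z : Fin 3 → ℤ | toR z ∈ P}.Finite := by
  obtain ⟨R, hR⟩ := hP.exists_norm_le
  apply Set.Finite.subset (Set.finite_Icc (fun _ => -⌈R⌉ : Fin 3 → ℤ) (fun _ => ⌈R⌉))
  intro z hz
  have h1 := hR _ hz
  have h2 : ∀ i, |(z i : ℝ)| ≤ R := fun i => (norm_le_pi_norm (toR z) i).trans h1
  have h3 : ∀ i, |z i| ≤ ⌈R⌉ := by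
    intro i
    have : ((|z i| : ℤ) : ℝ) ≤ ⌈R⌉ := by push_cast; exact (h2 i).trans (Int.le_ceil R)
    exact_mod_cast this
  exact ⟨fun i => (abs_le.mp (h3 i)).1, fun i => (abs_le.mp (h3 i)).2⟩

theorem VData.vecMul_inj {P v E M} (h : VData P v E M) {a b : Fin 3 → ℤ} (hab : Matrix.vecMul a E = Matrix.vecMul b E) : a = b := by
  have := congrArg (fun t => Matrix.vecMul t M) hab
  simpa [Matrix.vecMul_vecMul, mul_eq_one_comm.mp h.inv] using this

theorem VData.back {P v E M} (h : VData P v E M) (a : Fin 3 → ℤ) : Matrix.vecMul (Matrix.vecMul a M) E = a := by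
  simp [Matrix.vecMul_vecMul, h.inv]

theorem VData.forth {P v E M} (h : VData P v E M) (a : Fin 3 → ℤ) : Matrix.vecMul (Matrix.vecMul a E) M = a := by
  simp [Matrix.vecMul_vecMul, mul_eq_one_comm.mp h.inv]

theorem VData.core {P v E M} (h : VData P v E M) (hP : IsSmoothPolytope P) (hdim : affineSpan ℝ P = ⊤) (hsym : P = -P) :
    Core (SS P v E) (KK P v E) (pz (Matrix.vecMul (-v) M)) := by
  obtain ⟨V, hV⟩ := hP.1
  have hVP : ∀ u ∈ V, toR u ∈ P := fun u hu => by rw [hV]; exact subset_convexHull ℝ _ ⟨u, hu, rfl⟩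
  have hPc : Convex ℝ P := by rw [hV]; exact convex_convexHull ℝ _
  have hPb : Bornology.IsBounded P := by
    rw [hV]
    exact (isBounded_convexHull.mpr (V.finite_toSet.image toR).isBounded)
  have hsingle : ∀ i, Matrix.vecMul (Pi.single i 1) E = E.row i := by
    intro i; rw [Matrix.single_one_vecMul]
  refine ⟨?_, ?_, fun z hz => hz, ?_, ?_, ?_, ?_, ?_, ?_, ?_⟩
  · have : SS P v E = (fun z => v + Matrix.vecMul (tz z) E) ⁻¹' {z : Fin 3 → ℤ | toR z ∈ P} := by
      ext z; exact mem_SS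
    rw [this]
    apply (finite_lattice hPb).preimage
    intro a _ b _ hab
    exact tz_inj (h.vecMul_inj (add_left_cancel hab))
  · apply Set.Subset.antisymm
    · intro t ht
      have hc : Convex ℝ {x : Fin 3 → ℝ | pr (Matrix.vecMul (x - toR v) (M.map (Int.cast : ℤ → ℝ))) ∈ convexHull ℝ (c3 '' SS P v E)} := by
        intro x hx y hy a b ha hb hab
        have := (convex_convexHull ℝ (c3 '' SS P v E)) hx hy ha hb hab
        simp only [Set.mem_ofPred_eq]
        convert this using 1
        apply tr_inj
        rw [tr_add, tr_smul, tr_smul, tr_pr, tr_pr, tr_pr, ← Matrix.smul_vecMul, ← Matrix.smul_vecMul, ← Matrix.add_vecMul]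
        congr 1
        have : toR v = a • toR v + b • toR v := by rw [← add_smul, hab, one_smul]
        conv_lhs => rw [this]
        module
      have hsub : P ⊆ {x : Fin 3 → ℝ | pr (Matrix.vecMul (x - toR v) (M.map (Int.cast : ℤ → ℝ))) ∈ convexHull ℝ (c3 '' SS P v E)} := by
        conv_lhs => rw [hV]
        apply convexHull_min _ hc
        rintro _ ⟨u, hu, rfl⟩
        apply subset_convexHull ℝ _
        refine ⟨pz (Matrix.vecMul (u - v) M), ?_, ?_⟩
        · rw [mem_SS, tz_pz, h.back]
          simpa using hVP u hu
        · rw [c3_pz, toR_vecMul, toR_sub]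
      have := hsub ht
      simpa only [Set.mem_ofPred_eq, add_sub_cancel_left, h.coord, pr_tr] using this
    · apply convexHull_min
      · rintro _ ⟨z, hz, rfl⟩; exact hz
      · intro x hx y hy a b ha hb hab
        have := hPc hx hy ha hb hab
        simp only [KK, Set.mem_ofPred_eq]
        convert this using 1
        rw [tr_add, tr_smul, tr_smul, Matrix.add_vecMul, Matrix.smul_vecMul, Matrix.smul_vecMul]
        have : toR v = a • toR v + b • toR v := by rw [← add_smul, hab, one_smul]
        conv_lhs => rw [this]
        module
  · intro w hw p q r hmax
    have hw' := mem_SS.mp hw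
    have hext : toR (v + Matrix.vecMul (tz w) E) ∈ extremePoints ℝ P := by
      let f : (Fin 3 → ℝ) →ₗ[ℝ] ℝ :=
        { toFun := fun x => p * Matrix.vecMul x (M.map (Int.cast : ℤ → ℝ)) 0 + q * Matrix.vecMul x (M.map (Int.cast : ℤ → ℝ)) 1
            + r * Matrix.vecMul x (M.map (Int.cast : ℤ → ℝ)) 2
          map_add' := by
            intro x y
            simp only [Matrix.add_vecMul, Pi.add_apply]; ring
          map_smul' := by
            intro t x
            simp only [Matrix.smul_vecMul, Pi.smul_apply, smul_eq_mul, RingHom.id_apply]; ring }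
      have hf : ∀ z : ℤ × ℤ × ℤ, f (toR (v + Matrix.vecMul (tz z) E)) =
          ((p * z.1 + q * z.2.1 + r * z.2.2 : ℤ) : ℝ) + f (toR v) := by
        intro z
        rw [toR_add, map_add, add_comm]
        congr 1
        change (p : ℝ) * Matrix.vecMul (toR (Matrix.vecMul (tz z) E)) (M.map (Int.cast : ℤ → ℝ)) 0
          + q * Matrix.vecMul (toR (Matrix.vecMul (tz z) E)) (M.map (Int.cast : ℤ → ℝ)) 1
          + r * Matrix.vecMul (toR (Matrix.vecMul (tz z) E)) (M.map (Int.cast : ℤ → ℝ)) 2 = _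
        rw [← toR_vecMul, h.forth]
        simp [toR, tz]
      refine extreme_of_lin hV _ hw' f ?_
      rintro _ ⟨u, hu, rfl⟩ hne
      have hu' : u = v + Matrix.vecMul (tz (pz (Matrix.vecMul (u - v) M))) E := by
        rw [tz_pz, h.back]; simp
      have huS : pz (Matrix.vecMul (u - v) M) ∈ SS P v E := by
        rw [mem_SS, ← hu']; exact hVP u hu
      have hlt := hmax _ huS (by
        intro h'
        rw [h'] at hu'
        exact hne (by rw [hu']))
      rw [hu', hf, hf]
      have hlt' := (Int.cast_lt (R := ℝ)).mpr hlt
      linarith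
    obtain ⟨w', E', M', hww, hD⟩ := exists_vdata hP hdim hext
    have hww' := toR_inj hww
    subst hww'
    have hmem : ∀ i, w + pz (Matrix.vecMul (E'.row i) M) ∈ SS P v E := by
      intro i
      rw [mem_SS, tz_add, tz_pz, Matrix.add_vecMul, h.back, ← add_assoc]
      exact hD.gen i
    refine ⟨pz (Matrix.vecMul (E'.row 0) M), pz (Matrix.vecMul (E'.row 1) M), pz (Matrix.vecMul (E'.row 2) M), hmem 0, hmem 1, hmem 2, ?_⟩
    intro z hz
    have hz' := mem_SS.mp hz
    obtain ⟨m, hm⟩ : ∃ m, m = Matrix.vecMul (Matrix.vecMul (tz z - tz w) E) M' := ⟨_, rfl⟩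
    have hm0 : ∀ i, 0 ≤ m i := by
      intro i
      have := hD.cone _ hz' i
      rw [← toR_sub, ← toR_vecMul, add_sub_add_left_eq_sub, ← Matrix.sub_vecMul, ← hm] at this
      simpa [toR] using this
    have hm1 : tz z = tz w + (m 0 • Matrix.vecMul (E'.row 0) M + m 1 • Matrix.vecMul (E'.row 1) M + m 2 • Matrix.vecMul (E'.row 2) M) := by
      have h1 : m 0 • Matrix.vecMul (E'.row 0) M + m 1 • Matrix.vecMul (E'.row 1) M + m 2 • Matrix.vecMul (E'.row 2) M
         = Matrix.vecMul (Matrix.vecMul m E') M := by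
        rw [← Matrix.smul_vecMul, ← Matrix.smul_vecMul, ← Matrix.smul_vecMul, ← Matrix.add_vecMul, ← Matrix.add_vecMul]
        congr 1
        ext j
        simp [Matrix.vecMul, dotProduct, Fin.sum_univ_three]
      rw [h1, hm, hD.back, h.forth]
      simp
    refine ⟨m 0, m 1, m 2, hm0 0, hm0 1, hm0 2, ?_, ?_, ?_⟩
    · have := congrFun hm1 0
      simp [tz] at this
      simp only [pz]; linarith
    · have := congrFun hm1 1
      simp [tz] at this
      simp only [pz]; linarith
    · have := congrFun hm1 2
      simp [tz] at this
      simp only [pz]; linarith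
  · intro z hz
    have hz' := mem_SS.mp hz
    have : ∀ i, 0 ≤ tz z i := by
      intro i
      have := h.cone _ hz' i
      rw [← toR_sub, ← toR_vecMul, add_sub_cancel_left, h.forth] at this
      simpa [toR] using this
    exact ⟨this 0, this 1, this 2⟩
  · rw [mem_SS]
    have : tz (0, 0, 0) = 0 := by ext i; fin_cases i <;> rfl
    rw [this]; simpa using h.mem
  · rw [mem_SS]
    have : tz (1, 0, 0) = Pi.single 0 1 := by ext i; fin_cases i <;> rfl
    rw [this, hsingle]; exact h.gen 0
  · rw [mem_SS]
    have : tz (0, 1, 0) = Pi.single 1 1 := by ext i; fin_cases i <;> rfl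
    rw [this, hsingle]; exact h.gen 1
  · rw [mem_SS]
    have : tz (0, 0, 1) = Pi.single 2 1 := by ext i; fin_cases i <;> rfl
    rw [this, hsingle]; exact h.gen 2
  · intro z hz
    rw [mem_SS] at hz ⊢
    rw [tz_sub, tz_add, tz_pz, Matrix.sub_vecMul, Matrix.add_vecMul, h.back, hsym, Set.mem_neg, ← toR_neg]
    convert hz using 2
    abel

theorem vecMul_map_sum (f : (Fin 3 → ℝ) →L[ℝ] ℝ) (E : Matrix (Fin 3) (Fin 3) ℤ) (t : Fin 3 → ℝ) :
    f (Matrix.vecMul t (E.map (Int.cast : ℤ → ℝ))) = ∑ i, t i * f (toR (E.row i)) := by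
  have : Matrix.vecMul t (E.map (Int.cast : ℤ → ℝ)) = ∑ i, t i • toR (E.row i) := by
    ext j
    simp [Matrix.vecMul, dotProduct, toR, Matrix.row]
  rw [this, map_sum]
  simp

theorem VData.face {P v E M} (h : VData P v E M) (f : (Fin 3 → ℝ) →L[ℝ] ℝ) (h0 : (0 : Fin 3 → ℝ) ∈ P)
    (hf0 : 0 < f (toR v)) (hmax : ∀ x ∈ P, f x ≤ f (toR v)) {y} (hy : y ∈ P) (hfy : f y = f (toR v)) :
    ∃ i, Matrix.vecMul (y - toR v) (M.map (Int.cast : ℤ → ℝ)) i = 0 := by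
  have hE : ∀ i, f (toR (E.row i)) ≤ 0 := by
    intro i
    have := hmax _ (h.gen i)
    rw [toR_add, map_add] at this
    linarith
  have hx : ∀ x, f x - f (toR v) = ∑ i, Matrix.vecMul (x - toR v) (M.map (Int.cast : ℤ → ℝ)) i * f (toR (E.row i)) := by
    intro x
    rw [← vecMul_map_sum, h.coord', map_sub]
  obtain ⟨i, hi⟩ : ∃ i, f (toR (E.row i)) ≠ 0 := by
    by_contra! hall
    have := hx 0
    simp [hall] at this
    linarith
  refine ⟨i, ?_⟩
  have h1 := hx y
  rw [hfy, sub_self] at h1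
  have h2 := (Finset.sum_eq_zero_iff_of_nonpos (fun i _ => mul_nonpos_of_nonneg_of_nonpos (h.cone y hy i) (hE i))).mp h1.symm i (Finset.mem_univ i)
  exact (mul_eq_zero.mp h2).resolve_right hi

theorem poly_step {P : Set (Fin 3 → ℝ)} (hP : IsSmoothPolytope P) (hdim : affineSpan ℝ P = ⊤) (hsym : P = -P)
    (n : ℕ) (hn : 2 ≤ n) (p : Fin 3 → ℤ) (x : Fin 3 → ℝ) (hx : x ∈ P) (hp : toR p = (n : ℝ) • x) :
    ∃ q : Fin 3 → ℤ, toR q ∈ P ∧ ∃ z ∈ P, toR p - toR q = ((n : ℝ) - 1) • z := by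
  obtain ⟨V, hV⟩ := hP.1
  have hPc : Convex ℝ P := by rw [hV]; exact convex_convexHull ℝ _
  have hPk : IsCompact P := by
    rw [hV]; exact (V.finite_toSet.image toR).isCompact_convexHull (𝕜 := ℝ)
  have hPint : (interior P).Nonempty := by
    rw [hV, interior_convexHull_nonempty_iff_affineSpan_eq_top, ← affineSpan_convexHull, ← hV]
    exact hdim
  have h0i : (0 : Fin 3 → ℝ) ∈ interior P := by
    obtain ⟨a, ha⟩ := hPint
    have hna : -a ∈ interior P := by
      rw [mem_interior_iff_mem_nhds] at ha ⊢
      have h1 := (continuous_neg (G := Fin 3 → ℝ)).continuousAt.preimage_mem_nhds (x := -a) (by rw [neg_neg]; exact ha)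
      rw [hsym]; exact h1
    have := hPc.interior ha hna (by norm_num : (0:ℝ) ≤ 1/2) (by norm_num : (0:ℝ) ≤ 1/2) (by norm_num)
    simpa using this
  have h0 := interior_subset h0i
  by_cases hx0 : x = 0
  · subst hx0
    refine ⟨0, ?_, 0, h0, ?_⟩
    · convert h0 using 1; ext; simp [toR]
    · rw [hp]; ext; simp [toR]
  have hnhds : P ∈ nhds (0 : Fin 3 → ℝ) := mem_interior_iff_mem_nhds.mp h0i
  have hl0 : 0 < gauge P x := (gauge_pos (absorbent_nhds_zero hnhds) (NormedSpace.isVonNBounded_of_isBounded ℝ hPk.isBounded)).mpr hx0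
  have hl1 : gauge P x ≤ 1 := gauge_le_one_of_mem hx
  obtain ⟨l, hl⟩ : ∃ l, l = gauge P x := ⟨_, rfl⟩
  rw [← hl] at hl0 hl1
  obtain ⟨y, hyx⟩ : ∃ y, y = l⁻¹ • x := ⟨_, rfl⟩
  have hxy : x = l • y := by rw [hyx, smul_inv_smul₀ hl0.ne']
  have hyf : y ∈ frontier P := by
    rw [← gauge_eq_one_iff_mem_frontier hPc hnhds, hyx, gauge_smul_of_nonneg (inv_nonneg.mpr hl0.le), ← hl, smul_eq_mul, inv_mul_cancel₀ hl0.ne']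
  have hyP : y ∈ P := hPk.isClosed.frontier_subset hyf
  obtain ⟨f, hf⟩ := geometric_hahn_banach_open_point hPc.interior isOpen_interior (x := y) hyf.2
  have hfy : ∀ a ∈ P, f a ≤ f y := by
    intro a ha
    have h1 : a ∈ closure (interior P) := by
      rw [hPc.closure_interior_eq_closure_of_nonempty_interior hPint]; exact subset_closure ha
    have h2 : closure (interior P) ⊆ {a | f a ≤ f y} :=
      closure_minimal (fun a ha => (hf a ha).le) (isClosed_le f.continuous continuous_const)
    exact h2 h1
  have hfpos : 0 < f y := by simpa using hf 0 h0i
  have hexp : IsExposed ℝ P (f.toExposed P) := ContinuousLinearMap.toExposed.isExposed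
  have hyexp : y ∈ f.toExposed P := ⟨hyP, hfy⟩
  obtain ⟨w, hw⟩ := (hexp.isCompact hPk).extremePoints_nonempty ⟨y, hyexp⟩
  have hwf : f w = f y := le_antisymm (hfy w hw.1.1) (hw.1.2 y hyP)
  have hwP := hexp.isExtreme.extremePoints_subset_extremePoints hw
  obtain ⟨v, E, M, rfl, hD⟩ := exists_vdata hP hdim hwP
  obtain ⟨i, hi⟩ := hD.face f h0 (by rw [hwf]; exact hfpos) (by rw [hwf]; exact hfy) hyP hwf.symm
  have hi' : Matrix.vecMul (y - toR v) ((M.submatrix id (Equiv.swap i 2)).map (Int.cast : ℤ → ℝ)) 2 = 0 := by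
    rw [← hi]
    simp [Matrix.vecMul, dotProduct]
  have hD' := hD.perm (Equiv.swap i 2)
  generalize E.submatrix (Equiv.swap i 2) id = E' at hD'
  generalize M.submatrix id (Equiv.swap i 2) = M' at hD' hi'
  have hcore := hD'.core hP hdim hsym
  obtain ⟨q, hq, z, hz, hqz⟩ := hcore.step (pr (Matrix.vecMul (y - toR v) (M'.map (Int.cast : ℤ → ℝ))))
    (by simp only [KK, Set.mem_ofPred_eq, tr_pr, hD'.coord']; simpa using hyP) hi' l ⟨hl0.le, hl1⟩ n hn
    (pz (Matrix.vecMul (p - n • v) M')) (by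
      apply tr_inj
      rw [tr_c3, tz_pz, tr_smul, tr_add, tr_smul, tr_smul, tr_pr, tr_c3, tz_pz, toR_vecMul, toR_vecMul,
        ← Matrix.smul_vecMul, ← Matrix.smul_vecMul, ← Matrix.add_vecMul, ← Matrix.smul_vecMul]
      congr 1
      have : toR (n • v) = (n : ℝ) • toR v := by ext; simp [toR]
      rw [toR_sub, hp, this, toR_neg, hxy]
      module)
  refine ⟨v + Matrix.vecMul (tz q) E', mem_SS.mp hq, toR v + Matrix.vecMul (tr z) (E'.map (Int.cast : ℤ → ℝ)), hz, ?_⟩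
  have h1 := congrArg (fun t => Matrix.vecMul (tr t) (E'.map (Int.cast : ℤ → ℝ))) hqz
  simp only [tr_sub, tr_smul, tr_c3, tz_pz, Matrix.sub_vecMul, Matrix.smul_vecMul, ← toR_vecMul, hD'.back] at h1
  have : toR (n • v) = (n : ℝ) • toR v := by ext; simp [toR]
  rw [toR_sub, this] at h1
  rw [toR_add, smul_add, ← h1]
  module

/-- Every centrally symmetric 3-dimensional smooth lattice polytope has the
integer decomposition property. -/
theorem smooth_centrally_symmetric_dim3_IDP (P : Set (Fin 3 → ℝ))
    (hsmooth : IsSmoothPolytope P) (hdim : affineSpan ℝ P = ⊤) (hsym : P = -P) :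
    HasIDP P := by
  intro n hn
  induction n, hn using Nat.le_induction with
  | base =>
    rintro p ⟨x, hx, rfl⟩ hp
    simp only [Nat.cast_one, one_smul] at hp ⊢
    exact ⟨fun _ => x, fun _ => ⟨hx, hp⟩, by simp⟩
  | succ n hn ih =>
    rintro _ ⟨x, hx, rfl⟩ ⟨p, hp⟩
    obtain ⟨q, hq, z, hz, hqz⟩ := poly_step hsmooth hdim hsym (n + 1) (by omega) p x hx hp.symm
    obtain ⟨r, hr, hrs⟩ := ih (toR p - toR q) (by
      refine ⟨z, hz, ?_⟩
      rw [hqz]; push_cast; simp) ⟨p - q, (toR_sub p q).symm⟩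
    refine ⟨Fin.cons (toR q) r, ?_, ?_⟩
    · intro i
      refine Fin.cases ?_ (fun i => ?_) i
      · exact ⟨hq, q, rfl⟩
      · exact hr i
    · rw [Fin.sum_cons, hrs]
      simp only [← hp] at *
      simp
end

section
/- Every lattice zonotope has the integer decomposition property. -/
open Set Pointwise

/-- A lattice zonotope: a Minkowski sum of finitely many segments with
endpoints in `ℤ^d`. -/
def IsLatticeZonotope {d : ℕ} (Z : Set (Fin d → ℝ)) : Prop :=
  ∃ (m : ℕ) (u v : Fin m → (Fin d → ℤ)),
    Z = {x | ∃ p : Fin m → (Fin d → ℝ),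
      (∀ i, p i ∈ segment ℝ (toR (u i)) (toR (v i))) ∧ x = ∑ i, p i}


theorem sum_ite_lt_aux {d : ℕ} (N k : ℕ) (hk : k ≤ N) (u v : Fin d → ℤ) :
    ∑ j : Fin N, toR (if (j : ℕ) < k then v else u)
      = (N : ℝ) • toR u + (k : ℝ) • (toR v - toR u) := by
  have h1 : ∀ j : Fin N, toR (if (j : ℕ) < k then v else u)
      = toR u + (if (j : ℕ) < k then (1 : ℝ) else 0) • (toR v - toR u) := by
    intro j
    split_ifs <;> simp
  rw [Finset.sum_congr rfl (fun j _ => h1 j), Finset.sum_add_distrib, ← Finset.sum_smul]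
  have h2 : ∑ j : Fin N, (if (j : ℕ) < k then (1 : ℝ) else 0) = k := by
    rw [Fin.sum_univ_eq_sum_range (fun j => if j < k then (1 : ℝ) else 0) N,
      Finset.sum_ite, Finset.sum_const_zero, add_zero, Finset.sum_const]
    have : (Finset.range N).filter (fun j => j < k) = Finset.range k := by
      ext j; simp; omega
    rw [this]; simp
  rw [h2]
  simp [Nat.cast_smul_eq_nsmul]

theorem toR_sum_aux {d : ℕ} {ι : Type*} (s : Finset ι) (f : ι → Fin d → ℤ) :
    toR (∑ i ∈ s, f i) = ∑ i ∈ s, toR (f i) := by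
  ext x
  simp [toR, Finset.sum_apply]

/-- Every lattice zonotope has the integer decomposition property. -/
theorem latticeZonotope_hasIDP {d : ℕ} (Z : Set (Fin d → ℝ))
    (hZ : IsLatticeZonotope Z) : HasIDP Z := by
  obtain ⟨m, u, v, rfl⟩ := hZ
  intro n hn p hp hpl
  obtain ⟨N, rfl⟩ : ∃ N, n = N + 1 := ⟨n - 1, by omega⟩
  obtain ⟨x, ⟨y, hy, rfl⟩, rfl⟩ := hp
  have hy' : ∀ i, ∃ t : ℝ, 0 ≤ t ∧ t ≤ 1 ∧ toR (u i) + t • (toR (v i) - toR (u i)) = y i := by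
    intro i
    have := hy i
    rw [segment_eq_image'] at this
    obtain ⟨t, ht, h⟩ := this
    exact ⟨t, ht.1, ht.2, h⟩
  choose t ht0 ht1 hty using hy'
  let k : Fin m → ℕ := fun i => min ⌊((N + 1 : ℕ) : ℝ) * t i⌋₊ N
  have hkN : ∀ i, k i ≤ N := fun i => min_le_right _ _
  have hk0 : ∀ i, (k i : ℝ) ≤ ((N + 1 : ℕ) : ℝ) * t i := by
    intro i
    have h0 : 0 ≤ ((N + 1 : ℕ) : ℝ) * t i := mul_nonneg (Nat.cast_nonneg _) (ht0 i)
    exact le_trans (Nat.cast_le.mpr (min_le_left _ _)) (Nat.floor_le h0)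
  have hk1 : ∀ i, ((N + 1 : ℕ) : ℝ) * t i - k i ≤ 1 := by
    intro i
    rcases le_total ⌊((N + 1 : ℕ) : ℝ) * t i⌋₊ N with h | h
    · have : k i = ⌊((N + 1 : ℕ) : ℝ) * t i⌋₊ := min_eq_left h
      rw [this]
      linarith [Nat.lt_floor_add_one (((N + 1 : ℕ) : ℝ) * t i)]
    · have : k i = N := min_eq_right h
      rw [this]
      have := mul_le_mul_of_nonneg_left (ht1 i) (Nat.cast_nonneg (α := ℝ) (N + 1))
      push_cast at this ⊢
      linarith
  let w : Fin N → Fin d → ℤ := fun j => ∑ i, if (j : ℕ) < k i then v i else u i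
  let q0 : Fin d → ℝ := ∑ i, (toR (u i) +
    (((N + 1 : ℕ) : ℝ) * t i - k i) • (toR (v i) - toR (u i)))
  have hsum : q0 + ∑ j, toR (w j) = ((N + 1 : ℕ) : ℝ) • ∑ i, y i := by
    simp only [w, q0, toR_sum_aux]
    rw [Finset.sum_comm, ← Finset.sum_add_distrib, Finset.smul_sum]
    refine Finset.sum_congr rfl fun i _ => ?_
    rw [sum_ite_lt_aux N (k i) (hkN i), ← hty i]
    push_cast
    module
  refine ⟨Fin.cons q0 fun j => toR (w j), ?_, ?_⟩
  · intro i
    refine Fin.cases ?_ (fun j => ?_) i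
    · simp only [Fin.cons_zero]
      refine ⟨⟨_, fun i => ?_, rfl⟩, ?_⟩
      · rw [segment_eq_image']
        exact ⟨_, ⟨sub_nonneg.mpr (hk0 i), hk1 i⟩, rfl⟩
      · obtain ⟨z, hz⟩ := hpl
        refine ⟨z - ∑ j, w j, ?_⟩
        have h1 : toR (z - ∑ j, w j) = toR z - toR (∑ j, w j) := by
          ext x; simp [toR]
        rw [h1, toR_sum_aux, ← hz]
        exact eq_sub_of_add_eq hsum
    · simp only [Fin.cons_succ]
      refine ⟨⟨fun i => toR (if (j : ℕ) < k i then v i else u i), fun i => ?_, ?_⟩, w j, rfl⟩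
      · dsimp only
        split_ifs
        · exact right_mem_segment _ _ _
        · exact left_mem_segment _ _ _
      · exact toR_sum_aux _ _
  · rw [Fin.sum_univ_succ]
    simpa only [Fin.cons_zero, Fin.cons_succ] using hsum
end
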